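/- arXiv:2505.23557 — 7 statements merged into one kernel-verified Lean document; each statement's English description precedes it below -/
import Mathlib

section
/- Let p_{θ*} and p_θ be probability densities on ℝ^d (with respect to Lebesgue measure) and let ℓ_{θ*}, ℓ_θ : ℝ^d × ℝ^d → ℝ be measurable functions. Define, on ℝ^d × ℝ^d × {−1, 0, 1}, the densities q_{θ*}(x,y,z) = p_{θ*}(x) p_{θ*}(y) 𝟙{z = sign(ℓ_{θ*}(x,y))} and q_θ(x,y,z) = p_θ(x) p_θ(y) 𝟙{z = sign(ℓ_θ(x,y))}. Let G_0(θ*) = {(x,y) : |ℓ_{θ*}(x,y)| > 0}, G_0(θ) = {(x,y) : |ℓ_θ(x,y)| > 0}, D(θ*,θ) = {(x,y) : ℓ_{θ*}(x,y) · ℓ_θ(x,y) < 0}, and define the defect term B̃C(θ*,θ) = ∫_{D(θ*,θ) ∪ (G_0(θ*)^c Δ G_0(θ)^c)} √(p_{θ*}(x) p_{θ*}(y) p_θ(x) p_θ(y)) dx dy, where Δ denotes symmetric difference. Then ∑_{z ∈ {−1,0,1}} ∫∫ √(q_{θ*}(x,y,z) q_θ(x,y,z)) dx dy = BC(p_{θ*}^{⊗2},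 p_θ^{⊗2}) − B̃C(θ*,θ), where BC(P,Q) = ∫ √(pq) is the Bhattacharyya coefficient; equivalently, with H(P,Q) := 1 − BC(P,Q), one has H(q_{θ*}, q_θ) = B̃C(θ*,θ) + H(p_{θ*}^{⊗2}, p_θ^{⊗2}). -/
open MeasureTheory

/-- **Bhattacharyya coefficient decomposition for deterministic preferences.**
With `q_θ(x,y,z) = p_θ(x) p_θ(y) 𝟙{z = sign(ℓ_θ(x,y))}`, summing the Bhattacharyya integrand
over `z ∈ {−1,0,1}` gives `BC(p_{θ*}^{⊗2}, p_θ^{⊗2})` minus the defect term `B̃C(θ*,θ)`,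
the Bhattacharyya mass of the disagreement set `D(θ*,θ) ∪ (G₀(θ*)ᶜ Δ G₀(θ)ᶜ)`. -/
theorem stmt1 (d : ℕ)
    (pstar p : (Fin d → ℝ) → ℝ)
    (hpstar_meas : Measurable pstar) (hp_meas : Measurable p)
    (hpstar_nonneg : ∀ x, 0 ≤ pstar x) (hp_nonneg : ∀ x, 0 ≤ p x)
    (hpstar_int : ∫ x : Fin d → ℝ, pstar x = 1) (hp_int : ∫ x : Fin d → ℝ, p x = 1)
    (lstar l : (Fin d → ℝ) → (Fin d → ℝ) → ℝ)
    (hlstar_meas : Measurable fun w : (Fin d → ℝ) × (Fin d → ℝ) => lstar w.1 w.2)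
    (hl_meas : Measurable fun w : (Fin d → ℝ) × (Fin d → ℝ) => l w.1 w.2) :
    (∑ z ∈ ({-1, 0, 1} : Finset ℤ),
        ∫ w : (Fin d → ℝ) × (Fin d → ℝ),
          Real.sqrt
            ((pstar w.1 * pstar w.2 * (if (z : ℝ) = Real.sign (lstar w.1 w.2) then 1 else 0)) *
             (p w.1 * p w.2 * (if (z : ℝ) = Real.sign (l w.1 w.2) then 1 else 0))))
      = (∫ w : (Fin d → ℝ) × (Fin d → ℝ),
            Real.sqrt ((pstar w.1 * pstar w.2) * (p w.1 * p w.2)))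
        - ∫ w in ({w : (Fin d → ℝ) × (Fin d → ℝ) | lstar w.1 w.2 * l w.1 w.2 < 0} ∪
              symmDiff ({w : (Fin d → ℝ) × (Fin d → ℝ) | |lstar w.1 w.2| > 0})ᶜ
                ({w : (Fin d → ℝ) × (Fin d → ℝ) | |l w.1 w.2| > 0})ᶜ),
            Real.sqrt ((pstar w.1 * pstar w.2) * (p w.1 * p w.2)) := by
  have hsign : Measurable Real.sign := by
    unfold Real.sign
    exact Measurable.ite measurableSet_Iio measurable_const
      (Measurable.ite measurableSet_Ioi measurable_const measurable_const)
  have hi1 : Integrable pstar := by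
    by_contra h
    rw [integral_undef h] at hpstar_int
    norm_num at hpstar_int
  have hi2 : Integrable p := by
    by_contra h
    rw [integral_undef h] at hp_int
    norm_num at hp_int
  have hP1 : Integrable (fun w : (Fin d → ℝ) × (Fin d → ℝ) => pstar w.1 * pstar w.2) :=
    hi1.mul_prod hi1
  have hP2 : Integrable (fun w : (Fin d → ℝ) × (Fin d → ℝ) => p w.1 * p w.2) :=
    hi2.mul_prod hi2
  have hf : Integrable (fun w : (Fin d → ℝ) × (Fin d → ℝ) =>
      Real.sqrt ((pstar w.1 * pstar w.2) * (p w.1 * p w.2))) := by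
    refine (hP1.add hP2).mono' ?_ ?_
    · exact Measurable.aestronglyMeasurable (by fun_prop)
    · refine Filter.Eventually.of_forall fun w => ?_
      have h1 := mul_nonneg (hpstar_nonneg w.1) (hpstar_nonneg w.2)
      have h2 := mul_nonneg (hp_nonneg w.1) (hp_nonneg w.2)
      rw [Real.norm_of_nonneg (Real.sqrt_nonneg _)]
      simp only [Pi.add_apply]
      refine Real.sqrt_le_iff.2 ⟨by positivity, ?_⟩
      nlinarith [mul_nonneg h1 h2]
  have hm1 : Measurable fun w : (Fin d → ℝ) × (Fin d → ℝ) => Real.sign (lstar w.1 w.2) :=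
    hsign.comp hlstar_meas
  have hm2 : Measurable fun w : (Fin d → ℝ) × (Fin d → ℝ) => Real.sign (l w.1 w.2) :=
    hsign.comp hl_meas
  have hz : ∀ z : ℤ, (fun w : (Fin d → ℝ) × (Fin d → ℝ) => Real.sqrt
            ((pstar w.1 * pstar w.2 * (if (z : ℝ) = Real.sign (lstar w.1 w.2) then 1 else 0)) *
             (p w.1 * p w.2 * (if (z : ℝ) = Real.sign (l w.1 w.2) then 1 else 0)))) =
      Set.indicator {w : (Fin d → ℝ) × (Fin d → ℝ) | (z : ℝ) = Real.sign (lstar w.1 w.2) ∧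
        (z : ℝ) = Real.sign (l w.1 w.2)}
        (fun w => Real.sqrt ((pstar w.1 * pstar w.2) * (p w.1 * p w.2))) := by
    intro z
    funext w
    simp only [Set.indicator, Set.mem_ofPred_eq]
    generalize Real.sign (lstar w.1 w.2) = a
    generalize Real.sign (l w.1 w.2) = b
    generalize (z : ℝ) = c
    by_cases h1 : c = a
    · by_cases h2 : c = b
      · rw [if_pos h1, if_pos h2, if_pos ⟨h1, h2⟩, mul_one, mul_one]
      · rw [if_neg h2, if_neg (fun h : c = a ∧ c = b => h2 h.2), mul_zero, mul_zero, Real.sqrt_zero]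
    · rw [if_neg h1, if_neg (fun h : c = a ∧ c = b => h1 h.1), mul_zero, zero_mul, Real.sqrt_zero]
  have hzm : ∀ z : ℤ, MeasurableSet {w : (Fin d → ℝ) × (Fin d → ℝ) |
      (z : ℝ) = Real.sign (lstar w.1 w.2) ∧ (z : ℝ) = Real.sign (l w.1 w.2)} := fun z =>
    (measurableSet_eq_fun measurable_const hm1).inter (measurableSet_eq_fun measurable_const hm2)
  have hS : MeasurableSet ({w : (Fin d → ℝ) × (Fin d → ℝ) | lstar w.1 w.2 * l w.1 w.2 < 0} ∪
              symmDiff ({w : (Fin d → ℝ) × (Fin d → ℝ) | |lstar w.1 w.2| > 0})ᶜ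
                ({w : (Fin d → ℝ) × (Fin d → ℝ) | |l w.1 w.2| > 0})ᶜ) := by
    refine (measurableSet_lt (hlstar_meas.mul hl_meas) measurable_const).union
      (MeasurableSet.symmDiff ?_ ?_)
    · exact (measurableSet_lt measurable_const hlstar_meas.abs).compl
    · exact (measurableSet_lt measurable_const hl_meas.abs).compl
  rw [eq_sub_iff_add_eq, ← integral_add_compl hS hf, add_comm]
  congr 1
  rw [← integral_indicator hS.compl]
  simp_rw [hz]
  rw [← integral_finsetSum _ (fun z _ => hf.indicator (hzm z))]
  congr 1
  funext w
  rw [Finset.sum_insert (by decide), Finset.sum_insert (by decide), Finset.sum_singleton]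
  simp only [Set.indicator, Set.mem_ofPred_eq, Set.mem_compl_iff, Set.mem_union,
    Set.mem_symmDiff, gt_iff_lt, abs_pos, not_not]
  rcases lt_trichotomy (lstar w.1 w.2) 0 with h1 | h1 | h1 <;>
  rcases lt_trichotomy (l w.1 w.2) 0 with h2 | h2 | h2
  · norm_num [Real.sign_of_neg h1, Real.sign_of_neg h2, h1.ne, h2.ne,
      (mul_pos_of_neg_of_neg h1 h2).le]
  · norm_num [Real.sign_of_neg h1, h2, h1.ne]
  · norm_num [Real.sign_of_neg h1, Real.sign_of_pos h2, h1.ne, h2.ne',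
      mul_neg_of_neg_of_pos h1 h2]
  · norm_num [h1, Real.sign_of_neg h2, h2.ne]
  · norm_num [h1, h2]
  · norm_num [h1, Real.sign_of_pos h2, h2.ne']
  · norm_num [Real.sign_of_pos h1, Real.sign_of_neg h2, h1.ne', h2.ne,
      mul_neg_of_pos_of_neg h1 h2]
  · norm_num [Real.sign_of_pos h1, h2, h1.ne']
  · norm_num [Real.sign_of_pos h1, Real.sign_of_pos h2, h1.ne', h2.ne', (mul_pos h1 h2).le]
end

section
/- Let x, y, θ ∈ ℝ with x ≠ y, set s = (x + y)/2 and z = sign((y − x) s). Then z · (x − y)(θ − s) ≥ 0 holds if and only if both implications hold: (s > 0 → θ ≤ s) and (s < 0 → θ ≥ s). -/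
/-- **Hard constraint revealed by a deterministic Gaussian preference.**
For `x ≠ y`, `s = (x+y)/2` and `z = sign((y−x)s)`, consistency `z·(x−y)(θ−s) ≥ 0` holds
iff `θ ≤ s` whenever `s > 0` and `θ ≥ s` whenever `s < 0`. -/
theorem stmt6 (x y θ : ℝ) (hxy : x ≠ y) :
    0 ≤ Real.sign ((y - x) * ((x + y) / 2)) * ((x - y) * (θ - (x + y) / 2)) ↔
      ((x + y) / 2 > 0 → θ ≤ (x + y) / 2) ∧ ((x + y) / 2 < 0 → θ ≥ (x + y) / 2) := by
  generalize (x + y) / 2 = s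
  rcases lt_trichotomy s 0 with hs | hs | hs
  · rcases lt_or_gt_of_ne hxy with h | h
    · rw [Real.sign_of_neg (mul_neg_of_pos_of_neg (by linarith) hs)]
      refine ⟨fun H => ⟨fun h' => by linarith, fun _ => ?_⟩, fun H => ?_⟩
      · by_contra! hc
        nlinarith [mul_pos (sub_pos.2 h) (sub_pos.2 hc)]
      · nlinarith [mul_nonneg (sub_pos.2 h).le (sub_nonneg.2 (H.2 hs))]
    · rw [Real.sign_of_pos (mul_pos_of_neg_of_neg (by linarith) hs)]
      refine ⟨fun H => ⟨fun h' => by linarith, fun _ => ?_⟩, fun H => ?_⟩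
      · by_contra! hc
        nlinarith [mul_pos (sub_pos.2 h) (sub_pos.2 hc)]
      · nlinarith [mul_nonneg (sub_pos.2 h).le (sub_nonneg.2 (H.2 hs))]
  · subst hs
    simp
  · rcases lt_or_gt_of_ne hxy with h | h
    · rw [Real.sign_of_pos (mul_pos (by linarith) hs)]
      refine ⟨fun H => ⟨fun _ => ?_, fun h' => by linarith⟩, fun H => ?_⟩
      · by_contra! hc
        nlinarith [mul_pos (sub_pos.2 h) (sub_pos.2 hc)]
      · nlinarith [mul_nonneg (sub_pos.2 h).le (sub_nonneg.2 (H.1 hs))]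
    · rw [Real.sign_of_neg (mul_neg_of_neg_of_pos (by linarith) hs)]
      refine ⟨fun H => ⟨fun _ => ?_, fun h' => by linarith⟩, fun H => ?_⟩
      · by_contra! hc
        nlinarith [mul_pos (sub_pos.2 h) (sub_pos.2 hc)]
      · nlinarith [mul_nonneg (sub_pos.2 h).le (sub_nonneg.2 (H.1 hs))]
end

section
/- Let Σ be a d × d positive definite matrix, μ ∈ ℝ^d, θ* = Σ^{−1} μ, and let X, Y be independent random vectors each with the multivariate Gaussian distribution N(μ, Σ) on ℝ^d. Then for every nonzero u ∈ ℝ^d, P( ⟨X − Y, θ* − Σ^{−1}(X + Y)/2⟩ · ⟨u, X − Y⟩ < 0 ) = 1/2. -/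
open MeasureTheory Matrix Real

/-- The Gaussian measure `N(μ, Σ)` on `ℝ^d`, defined through its density
`x ↦ ((2π)^d det Σ)^{−1/2} exp(−(x−μ)ᵀ Σ⁻¹ (x−μ)/2)` with respect to Lebesgue measure. -/
noncomputable def gaussMeasure (d : ℕ) (S : Matrix (Fin d) (Fin d) ℝ) (μv : Fin d → ℝ) :
    Measure (Fin d → ℝ) :=
  (volume : Measure (Fin d → ℝ)).withDensity fun x =>
    ENNReal.ofReal ((Real.sqrt ((2 * π) ^ d * S.det))⁻¹ *
      Real.exp (-((x - μv) ⬝ᵥ (S⁻¹ *ᵥ (x - μv))) / 2))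

lemma aux_fact (d : ℕ) (S : Matrix (Fin d) (Fin d) ℝ) (hS : S.PosDef) :
    ∃ C : Matrix (Fin d) (Fin d) ℝ, S⁻¹ = Cᵀ * C ∧ C.det ≠ 0 := by
  open scoped MatrixOrder ComplexOrder Matrix.Norms.L2Operator in
  obtain ⟨C, h⟩ := CStarAlgebra.nonneg_iff_eq_star_mul_self.1 hS.inv.posSemidef.nonneg
  have h' : S⁻¹ = Cᵀ * C := by simpa [star_eq_conjTranspose] using h
  refine ⟨C, h', fun h0 => ?_⟩
  have := hS.inv.det_pos
  rw [h', det_mul, h0] at this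
  simp at this

lemma aux_quad {d : ℕ} {T C : Matrix (Fin d) (Fin d) ℝ} (h : T = Cᵀ * C)
    (x y : Fin d → ℝ) : x ⬝ᵥ (T *ᵥ y) = (C *ᵥ x) ⬝ᵥ (C *ᵥ y) := by
  rw [h, ← mulVec_mulVec, dotProduct_mulVec, vecMul_transpose]

lemma aux_meas (d : ℕ) (S : Matrix (Fin d) (Fin d) ℝ) (μv : Fin d → ℝ) :
    Measurable fun x : Fin d → ℝ => ENNReal.ofReal ((Real.sqrt ((2 * π) ^ d * S.det))⁻¹ *
      Real.exp (-((x - μv) ⬝ᵥ (S⁻¹ *ᵥ (x - μv))) / 2)) := by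
  have : Continuous fun x : Fin d → ℝ => ((Real.sqrt ((2 * π) ^ d * S.det))⁻¹ *
      Real.exp (-((x - μv) ⬝ᵥ (S⁻¹ *ᵥ (x - μv))) / 2)) := by fun_prop
  exact this.measurable.ennreal_ofReal

lemma aux_std (d : ℕ) :
    ∫ x : Fin d → ℝ, Real.exp (-(x ⬝ᵥ x) / 2) = Real.sqrt ((2 * π) ^ d) := by
  have h1 : ∀ x : Fin d → ℝ, Real.exp (-(x ⬝ᵥ x) / 2)
      = ∏ i, (fun t : ℝ => Real.exp (-(1/2) * t ^ 2)) (x i) := by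
    intro x
    simp only [dotProduct]
    rw [← Real.exp_sum, ← Finset.mul_sum]
    congr 1
    simp only [pow_two]
    ring
  rw [integral_congr_ae (ae_of_all _ h1)]
  rw [integral_fintype_prod_volume_eq_pow (𝕜 := ℝ) (ι := Fin d)
    (fun t : ℝ => Real.exp (-(1/2) * t ^ 2)), integral_gaussian, Fintype.card_fin]
  symm
  rw [Real.sqrt_eq_iff_mul_self_eq (by positivity) (by positivity), ← mul_pow,
    Real.mul_self_sqrt (by positivity)]
  congr 1
  ring

lemma aux_prob (d : ℕ) (S : Matrix (Fin d) (Fin d) ℝ) (hS : S.PosDef) (μv : Fin d → ℝ) :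
    IsProbabilityMeasure (gaussMeasure d S μv) := by
  obtain ⟨C, hC, hdet⟩ := aux_fact d S hS
  constructor
  have hSd := hS.det_pos
  have hint : ∫ x : Fin d → ℝ, (Real.sqrt ((2 * π) ^ d * S.det))⁻¹ *
      Real.exp (-((x - μv) ⬝ᵥ (S⁻¹ *ᵥ (x - μv))) / 2) = 1 := by
    rw [integral_sub_right_eq_self (fun x : Fin d → ℝ => (Real.sqrt ((2 * π) ^ d * S.det))⁻¹ *
      Real.exp (-(x ⬝ᵥ (S⁻¹ *ᵥ x)) / 2)) μv, integral_const_mul]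
    have h2 : ∫ x : Fin d → ℝ, Real.exp (-(x ⬝ᵥ (S⁻¹ *ᵥ x)) / 2)
        = |C.det⁻¹| * Real.sqrt ((2 * π) ^ d) := by
      rw [← aux_std]
      have h3 : ∫ x, Real.exp (-(x ⬝ᵥ x) / 2) ∂(Measure.map (toLin' C) volume)
          = ∫ x : Fin d → ℝ, Real.exp (-((toLin' C x) ⬝ᵥ (toLin' C x)) / 2) := by
        apply integral_map
        · exact (LinearMap.continuous_of_finiteDimensional (toLin' C)).measurable.aemeasurable
        · exact Continuous.aestronglyMeasurable (by fun_prop)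
      simp_rw [aux_quad hC]
      simp only [toLin'_apply] at h3
      rw [← h3, Real.map_matrix_volume_pi_eq_smul_volume_pi hdet, integral_smul_measure,
        ENNReal.toReal_ofReal (abs_nonneg _), smul_eq_mul]
    have h4 : |C.det⁻¹| = Real.sqrt S.det := by
      rw [← Real.sqrt_sq_eq_abs]
      congr 1
      have h5 : S.det * (C.det * C.det) = 1 := by
        have : S⁻¹.det = C.det * C.det := by rw [hC, det_mul, det_transpose]
        rw [← this, det_nonsing_inv, Ring.inverse_eq_inv', mul_inv_cancel₀ hSd.ne']
      field_simp
      linarith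
    rw [h2, h4, Real.sqrt_mul (by positivity)]
    have : 0 < √((2 * π) ^ d) := by positivity
    have : 0 < √S.det := by positivity
    field_simp
  have hI : Integrable fun x : Fin d → ℝ => (Real.sqrt ((2 * π) ^ d * S.det))⁻¹ *
      Real.exp (-((x - μv) ⬝ᵥ (S⁻¹ *ᵥ (x - μv))) / 2) := by
    by_contra h
    rw [integral_undef h] at hint
    exact zero_ne_one hint
  rw [gaussMeasure, withDensity_apply _ MeasurableSet.univ, Measure.restrict_univ,
    ← ofReal_integral_eq_lintegral_ofReal hI (ae_of_all _ fun x => by positivity), hint]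
  simp

lemma aux_refl (d : ℕ) (S : Matrix (Fin d) (Fin d) ℝ) (μv : Fin d → ℝ) :
    MeasurePreserving (fun x => (2 : ℝ) • μv - x) (gaussMeasure d S μv) (gaussMeasure d S μv) := by
  have hm : Measurable (fun x : Fin d → ℝ => (2 : ℝ) • μv - x) := by fun_prop
  refine ⟨hm, ?_⟩
  ext s hs
  rw [Measure.map_apply hm hs, gaussMeasure, withDensity_apply _ (hm hs), withDensity_apply _ hs,
    ← lintegral_indicator (hm hs), ← lintegral_indicator hs]
  rw [← lintegral_sub_left_eq_self _ ((2 : ℝ) • μv)]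
  congr 1
  ext x
  have h1 : (2 : ℝ) • μv - x - μv = -(x - μv) := by
    rw [two_smul]; abel
  have h2 : ((2 : ℝ) • μv - x ∈ (fun x => (2 : ℝ) • μv - x) ⁻¹' s) = (x ∈ s) := by
    rw [Set.mem_preimage, sub_sub_cancel]
  by_cases hx : x ∈ s
  · have hx' := h2.symm ▸ hx
    rw [Set.indicator_of_mem hx, Set.indicator_of_mem hx']
    simp only [h1, mulVec_neg, dotProduct_neg, neg_dotProduct, neg_neg]
  · have hx' := h2.symm ▸ hx
    rw [Set.indicator_of_notMem hx, Set.indicator_of_notMem hx']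

lemma aux_null (d : ℕ) (S : Matrix (Fin d) (Fin d) ℝ) (hS : S.PosDef) (μv : Fin d → ℝ)
    (u : Fin d → ℝ) (hu : u ≠ 0) (x : Fin d → ℝ) :
    volume {y : Fin d → ℝ |
      ((x - y) ⬝ᵥ (S⁻¹ *ᵥ μv - S⁻¹ *ᵥ ((2 : ℝ)⁻¹ • (x + y)))) * (u ⬝ᵥ (x - y)) = 0} = 0 := by
  obtain ⟨C, hC, hdet⟩ := aux_fact d S hS
  have hne : Nonempty (Fin d) := by
    by_contra h
    rw [not_nonempty_iff] at h
    exact hu (Subsingleton.elim _ _)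
  have hA : volume {y : Fin d → ℝ | u ⬝ᵥ (x - y) = 0} = 0 := by
    let p : Submodule ℝ (Fin d → ℝ) := LinearMap.ker (dotProductBilin ℝ ℝ u)
    have hp : p ≠ ⊤ := by
      intro h
      have : u ∈ p := h ▸ Submodule.mem_top
      exact hu (dotProduct_self_eq_zero.1 (by simpa [p] using this))
    have h0 := Measure.addHaar_submodule volume p hp
    rw [← (Measure.measurePreserving_sub_left volume x).measure_preimage
      p.closed_of_finiteDimensional.measurableSet.nullMeasurableSet] at h0
    convert h0 using 2
    ext y
    simp [p]
  have hB : volume {y : Fin d → ℝ | (C *ᵥ (y - μv)) ⬝ᵥ (C *ᵥ (y - μv))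
      = (C *ᵥ (x - μv)) ⬝ᵥ (C *ᵥ (x - μv))} = 0 := by
    set r := (C *ᵥ (x - μv)) ⬝ᵥ (C *ᵥ (x - μv)) with hr
    have hr0 : 0 ≤ r := Finset.sum_nonneg fun i _ => mul_self_nonneg _
    have h0 := Measure.addHaar_sphere (volume : Measure (EuclideanSpace ℝ (Fin d))) 0 (√r)
    rw [← (PiLp.volume_preserving_toLp (Fin d)).measure_preimage
      Metric.isClosed_sphere.measurableSet.nullMeasurableSet] at h0
    have h1 := Measure.addHaar_preimage_linearMap (volume : Measure (Fin d → ℝ))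
      (f := toLin' C) (by rwa [LinearMap.det_toLin']) (WithLp.toLp 2 ⁻¹' Metric.sphere 0 (√r))
    rw [h0, mul_zero, ← measure_preimage_add_right volume (-μv)] at h1
    convert h1 using 2
    ext y
    simp only [Set.mem_ofPred_eq, Set.mem_preimage, toLin'_apply, mem_sphere_zero_iff_norm,
      ← sub_eq_add_neg]
    rw [EuclideanSpace.norm_eq, Real.sqrt_inj (by positivity) hr0]
    simp [dotProduct, pow_two]
  refine measure_mono_null ?_ (measure_union_null hA hB)
  intro y hy
  rcases mul_eq_zero.1 hy with h | h
  · right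
    have e1 : x - y = (x - μv) - (y - μv) := by abel
    have e2 : μv - (2 : ℝ)⁻¹ • (x + y) = -((2 : ℝ)⁻¹ • ((x - μv) + (y - μv))) := by
      ext i; simp; ring
    rw [← mulVec_sub, e2, e1, aux_quad hC] at h
    simp only [mulVec_neg, mulVec_smul, mulVec_add, dotProduct_neg, dotProduct_smul] at h
    rw [mulVec_sub] at h
    simp only [Set.mem_ofPred_eq]
    generalize C *ᵥ (x - μv) = a at *
    generalize C *ᵥ (y - μv) = b at *
    simp only [sub_dotProduct, dotProduct_add, smul_eq_mul] at h
    rw [dotProduct_comm b a] at h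
    linarith
  · left; exact h

theorem stmt7 (d : ℕ) (S : Matrix (Fin d) (Fin d) ℝ) (hS : S.PosDef) (μv : Fin d → ℝ)
    (u : Fin d → ℝ) (hu : u ≠ 0) :
    ((gaussMeasure d S μv).prod (gaussMeasure d S μv))
        {w : (Fin d → ℝ) × (Fin d → ℝ) |
          ((w.1 - w.2) ⬝ᵥ (S⁻¹ *ᵥ μv - S⁻¹ *ᵥ ((2 : ℝ)⁻¹ • (w.1 + w.2)))) *
            (u ⬝ᵥ (w.1 - w.2)) < 0}
      = 1 / 2 := by
  have := aux_prob d S hS μv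
  set γ := gaussMeasure d S μv with hγ
  set F : (Fin d → ℝ) × (Fin d → ℝ) → ℝ := fun w =>
    ((w.1 - w.2) ⬝ᵥ (S⁻¹ *ᵥ μv - S⁻¹ *ᵥ ((2 : ℝ)⁻¹ • (w.1 + w.2)))) * (u ⬝ᵥ (w.1 - w.2)) with hF
  change (γ.prod γ) {w | F w < 0} = 1 / 2
  have hFm : Measurable F := by
    have : Continuous F := by fun_prop
    exact this.measurable
  have hneg : MeasurableSet {w | F w < 0} := measurableSet_lt hFm measurable_const
  have hpos : MeasurableSet {w | 0 < F w} := measurableSet_lt measurable_const hFm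
  have hzero : MeasurableSet {w | F w = 0} := measurableSet_eq_fun hFm measurable_const
  have hsym : (γ.prod γ) {w | F w < 0} = (γ.prod γ) {w | 0 < F w} := by
    have hr := aux_refl d S μv
    have hmp := (hr.prod hr).comp
      (Measure.measurePreserving_swap (μ := gaussMeasure d S μv) (ν := gaussMeasure d S μv))
    rw [← hmp.measure_preimage hneg.nullMeasurableSet]
    congr 1
    ext ⟨x, y⟩
    have key : F (2 • μv - y, 2 • μv - x) = - F (x, y) := by
      simp only [hF]
      have e1 : (2 : ℕ) • μv - y - (2 • μv - x) = x - y := by abel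
      have e2 : μv - (2 : ℝ)⁻¹ • ((2 : ℕ) • μv - y + (2 • μv - x))
          = - (μv - (2 : ℝ)⁻¹ • (x + y)) := by
        ext i; simp; ring
      rw [← mulVec_sub, ← mulVec_sub, e1, e2, mulVec_neg, dotProduct_neg, neg_mul]
    have e3 : (2 : ℝ) • μv = (2 : ℕ) • μv := by rw [two_smul, two_smul]
    simp only [Set.mem_preimage, Set.mem_ofPred_eq, Function.comp_apply, Prod.swap_prod_mk,
      Prod.map_apply, e3, key, neg_lt_zero]
  have hnull : (γ.prod γ) {w | F w = 0} = 0 := by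
    have hac : γ ≪ volume := withDensity_absolutelyContinuous _ _
    rw [Measure.measure_prod_null hzero]
    exact ae_of_all _ fun x => hac (aux_null d S hS μv u hu x)
  have htot : (γ.prod γ) {w | F w < 0} + (γ.prod γ) {w | 0 < F w} = 1 := by
    rw [← measure_union _ hpos]
    · rw [← prob_compl_eq_zero_iff (hneg.union hpos)]
      refine measure_mono_null ?_ hnull
      intro w hw
      simp only [Set.mem_compl_iff, Set.mem_union, Set.mem_ofPred_eq, not_or, not_lt] at hw
      exact le_antisymm hw.2 hw.1
    · rw [Set.disjoint_left]
      intro w h1 h2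
      simp only [Set.mem_ofPred_eq] at h1 h2
      exact lt_asymm h1 h2
  rw [← hsym, ← two_mul] at htot
  rw [ENNReal.eq_div_iff (by simp) (by simp), htot]
end

section
/- Let d ≥ 2, let Σ be a d × d positive definite matrix, and for θ ∈ ℝ^d let p_θ(x) = ((2π)^d det Σ)^{−1/2} exp(−(x − Σθ)ᵀ Σ^{−1} (x − Σθ)/2) be the Gaussian density with natural parameter θ, and let ℓ_θ(x,y) = ⟨x − y, θ − Σ^{−1}(x+y)/2⟩. For θ*, θ ∈ ℝ^d define B̃C(θ*, θ) = ∫_{{(x,y) : ℓ_{θ*}(x,y)·ℓ_θ(x,y) < 0}} √(p_{θ*}(x) p_{θ*}(y) p_θ(x) p_θ(y)) dx dy. Then B̃C(θ*, θ) ≤ (4/(d−1)) · (Γ(d/2) / (π · Γ((d−1)/2))) · ‖θ* − θ‖_Σ, where ‖θ‖_Σ = √(θᵀΣθ) and Γ is the Gamma function. -/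
open MeasureTheory Matrix Real

/-- The Gaussian density with natural parameter `θ` (mean `Σθ`, covariance `Σ`):
`x ↦ ((2π)^d det Σ)^{−1/2} exp(−(x−Σθ)ᵀ Σ⁻¹ (x−Σθ)/2)`. -/
noncomputable def gaussDensityNat (d : ℕ) (S : Matrix (Fin d) (Fin d) ℝ) (θ : Fin d → ℝ)
    (x : Fin d → ℝ) : ℝ :=
  (Real.sqrt ((2 * π) ^ d * S.det))⁻¹ *
    Real.exp (-((x - S *ᵥ θ) ⬝ᵥ (S⁻¹ *ᵥ (x - S *ᵥ θ))) / 2)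

/-- The Gaussian log-likelihood preference `ℓ_θ(x,y) = ⟨x − y, θ − Σ⁻¹(x+y)/2⟩`. -/
noncomputable def gaussPref (d : ℕ) (S : Matrix (Fin d) (Fin d) ℝ) (θ : Fin d → ℝ)
    (x y : Fin d → ℝ) : ℝ :=
  (x - y) ⬝ᵥ (θ - S⁻¹ *ᵥ ((2 : ℝ)⁻¹ • (x + y)))


open ProbabilityTheory in
lemma aux_sq (d : ℕ) (hd : 2 ≤ d) (D : EuclideanSpace ℝ (Fin d)) :
    ∫ a, (inner ℝ a D / ‖a‖) ^ 2 ∂(stdGaussian (EuclideanSpace ℝ (Fin d))) ≤ ‖D‖ ^ 2 / d := by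
  set g := stdGaussian (EuclideanSpace ℝ (Fin d))
  have key : ∀ v w : EuclideanSpace ℝ (Fin d), ‖v‖ = ‖w‖ →
      ∫ a, (inner ℝ a v / ‖a‖) ^ 2 ∂g = ∫ a, (inner ℝ a w / ‖a‖) ^ 2 ∂g := by
    intro v w h
    set R : EuclideanSpace ℝ (Fin d) ≃ₗᵢ[ℝ] EuclideanSpace ℝ (Fin d) := (Submodule.span ℝ {v - w})ᗮ.reflection
    have hR : R v = w := Submodule.reflection_sub h
    have hm : g.map R = g := stdGaussian_map R
    conv_rhs => rw [← hm, integral_map (R.continuous.measurable.aemeasurable)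
      (Measurable.aestronglyMeasurable (by fun_prop))]
    congr 1; ext a
    rw [← hR, R.inner_map_map, R.norm_map]
  have hint : ∀ v : EuclideanSpace ℝ (Fin d), Integrable (fun a ↦ (inner ℝ a v / ‖a‖) ^ 2) g := by
    intro v
    refine Integrable.of_bound (C := ‖v‖ ^ 2) (Measurable.aestronglyMeasurable (by fun_prop)) ?_
    refine Filter.Eventually.of_forall fun a ↦ ?_
    rw [Real.norm_eq_abs, abs_of_nonneg (sq_nonneg _), sq_le_sq, abs_norm, abs_div, abs_norm]
    refine div_le_of_le_mul₀ (norm_nonneg _) (norm_nonneg _) ?_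
    rw [mul_comm]
    exact abs_real_inner_le_norm a v
  have hd0 : (0 : ℝ) < d := by positivity
  rw [le_div_iff₀ hd0]
  have h1 : (∫ a, (inner ℝ a D / ‖a‖) ^ 2 ∂g) * d
      = ∑ i : Fin d, ∫ a, (inner ℝ a (‖D‖ • EuclideanSpace.single i (1:ℝ)) / ‖a‖) ^ 2 ∂g := by
    rw [Finset.sum_congr rfl (fun i _ ↦ key _ D (by simp [norm_smul]))]
    simp [mul_comm]
  rw [h1, ← integral_finsetSum _ (fun i _ ↦ hint _)]
  calc _ ≤ ∫ a : EuclideanSpace ℝ (Fin d), ‖D‖ ^ 2 ∂g := by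
        refine integral_mono (integrable_finsetSum _ (fun i _ ↦ hint _)) (integrable_const _) ?_
        intro a
        simp only [inner_smul_right, EuclideanSpace.inner_single_right, div_pow, mul_pow]
        rw [← Finset.sum_div, ← Finset.mul_sum]
        simp only [one_pow, one_mul, conj_trivial]
        rw [← EuclideanSpace.real_norm_sq_eq]
        refine div_le_of_le_mul₀ (by positivity) (by positivity) le_rfl
    _ = _ := by simp

open ProbabilityTheory in
lemma aux_abs (d : ℕ) (hd : 2 ≤ d) (D : EuclideanSpace ℝ (Fin d)) :
    Integrable (fun a ↦ |inner ℝ a D| / ‖a‖) (stdGaussian (EuclideanSpace ℝ (Fin d))) ∧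
    ∫ a, |inner ℝ a D| / ‖a‖ ∂(stdGaussian (EuclideanSpace ℝ (Fin d))) ≤ ‖D‖ / √d := by
  set g := stdGaussian (EuclideanSpace ℝ (Fin d))
  have hb : ∀ a : EuclideanSpace ℝ (Fin d), |inner ℝ a D| / ‖a‖ ≤ ‖D‖ := by
    intro a
    refine div_le_of_le_mul₀ (norm_nonneg _) (norm_nonneg _) ?_
    rw [mul_comm]
    exact abs_real_inner_le_norm a D
  have hint : Integrable (fun a ↦ |inner ℝ a D| / ‖a‖) g := by
    refine Integrable.of_bound (C := ‖D‖) (Measurable.aestronglyMeasurable (by fun_prop)) ?_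
    refine Filter.Eventually.of_forall fun a ↦ ?_
    rw [Real.norm_eq_abs, abs_of_nonneg (by positivity)]
    exact hb a
  refine ⟨hint, ?_⟩
  have hint2 : Integrable (fun a ↦ (inner ℝ a D / ‖a‖) ^ 2) g := by
    refine Integrable.of_bound (C := ‖D‖ ^ 2) (Measurable.aestronglyMeasurable (by fun_prop)) ?_
    refine Filter.Eventually.of_forall fun a ↦ ?_
    rw [Real.norm_eq_abs, abs_of_nonneg (sq_nonneg _), sq_le_sq, abs_norm, abs_div, abs_norm]
    exact hb a
  rcases eq_or_ne D 0 with rfl | hD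
  · simp
  have hd0 : (0 : ℝ) < d := by positivity
  have hs : 0 < ‖D‖ / √d := by positivity
  set s := ‖D‖ / √d
  calc _ ≤ ∫ a : EuclideanSpace ℝ (Fin d), ((inner ℝ a D / ‖a‖) ^ 2 / (2 * s) + s / 2) ∂g := by
        refine integral_mono hint ((hint2.div_const _).add (integrable_const _)) ?_
        intro a
        have : (inner ℝ a D / ‖a‖) ^ 2 = (|inner ℝ a D| / ‖a‖) ^ 2 := by
          rw [div_pow, div_pow, sq_abs]
        simp only [this]
        set t := |inner ℝ a D| / ‖a‖
        have : t ^ 2 / (2 * s) + s / 2 - t = (t - s) ^ 2 / (2 * s) := by field_simp; ring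
        have : 0 ≤ (t - s) ^ 2 / (2 * s) := by positivity
        linarith
    _ = (∫ a : EuclideanSpace ℝ (Fin d), (inner ℝ a D / ‖a‖) ^ 2 ∂g) / (2 * s) + s / 2 := by
        rw [integral_add (hint2.div_const _) (integrable_const _), integral_div]; simp
    _ ≤ (‖D‖ ^ 2 / d) / (2 * s) + s / 2 := by gcongr; exact aux_sq d hd D
    _ = s := by
        have : ‖D‖ ^ 2 / d = s ^ 2 := by simp only [s, div_pow]; rw [Real.sq_sqrt hd0.le]
        rw [this]; field_simp; ring

open ProbabilityTheory in
lemma aux_gauss (v : NNReal) (hv : v ≠ 0) (t : ℝ) :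
    gaussianReal 0 v {z | |z| < t} ≤ ENNReal.ofReal (2 * t * (√(2 * π * v))⁻¹) := by
  have hs : {z : ℝ | |z| < t} = Set.Ioo (-t) t := by ext; simp [abs_lt]
  rw [gaussianReal_apply 0 hv, hs]
  calc _ ≤ ∫⁻ x in Set.Ioo (-t) t, ENNReal.ofReal ((√(2 * π * v))⁻¹) := by
        refine lintegral_mono fun x ↦ ?_
        rw [gaussianPDF]
        refine ENNReal.ofReal_le_ofReal ?_
        rw [gaussianPDFReal]
        refine mul_le_of_le_one_right (by positivity) ?_
        rw [Real.exp_le_one_iff]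
        have : 0 ≤ (x - 0) ^ 2 / (2 * (v:ℝ)) := by positivity
        rw [neg_div]; linarith
    _ = _ := by
        rw [lintegral_const, Measure.restrict_apply_univ, Real.volume_Ioo, mul_comm,
          ← ENNReal.ofReal_mul' (by positivity)]
        ring_nf

open ProbabilityTheory in
lemma aux_fiber (d : ℕ) (D a : EuclideanSpace ℝ (Fin d)) :
    stdGaussian (EuclideanSpace ℝ (Fin d)) {b | √2 * |inner ℝ a b| < |inner ℝ a D|}
      ≤ ENNReal.ofReal ((√π)⁻¹ * (|inner ℝ a D| / ‖a‖)) := by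
  rcases eq_or_ne a 0 with rfl | ha
  · simp
  have hn : 0 < ‖a‖ := norm_pos_iff.2 ha
  set g := stdGaussian (EuclideanSpace ℝ (Fin d))
  have hm : g.map (innerSL ℝ a) = gaussianReal 0 (‖a‖ ^ 2).toNNReal := by
    rw [IsGaussian.map_eq_gaussianReal, integral_strongDual_stdGaussian, variance_dual_stdGaussian,
      innerSL_apply_norm]
  have hs : {b : EuclideanSpace ℝ (Fin d) | √2 * |inner ℝ a b| < |inner ℝ a D|}
      = (innerSL ℝ a) ⁻¹' {z | |z| < |inner ℝ a D| / √2} := by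
    ext b
    simp only [Set.mem_ofPred_eq, Set.mem_preimage, innerSL_apply_apply]
    rw [lt_div_iff₀ (by positivity), mul_comm]
  rw [hs, ← Measure.map_apply (by fun_prop) (by measurability), hm]
  refine (aux_gauss _ (by simp [ha]) _).trans (ENNReal.ofReal_le_ofReal ?_)
  rw [Real.coe_toNNReal _ (by positivity), Real.sqrt_mul (by positivity), Real.sqrt_mul (by positivity),
    Real.sqrt_sq hn.le]
  apply le_of_eq
  field_simp
  rw [Real.sq_sqrt (by norm_num)]
  ring

open ProbabilityTheory in
lemma aux_core (d : ℕ) (hd : 2 ≤ d) (D : EuclideanSpace ℝ (Fin d)) :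
    ((stdGaussian (EuclideanSpace ℝ (Fin d))).prod (stdGaussian (EuclideanSpace ℝ (Fin d))))
      {p | √2 * |inner ℝ p.1 p.2| < |inner ℝ p.1 D|}
      ≤ ENNReal.ofReal ((√π)⁻¹ * (‖D‖ / √d)) := by
  rw [Measure.prod_apply (measurableSet_lt (by fun_prop) (by fun_prop))]
  obtain ⟨h1, h2⟩ := aux_abs d hd D
  calc _ ≤ ∫⁻ a, ENNReal.ofReal ((√π)⁻¹ * (|inner ℝ a D| / ‖a‖)) ∂stdGaussian (EuclideanSpace ℝ (Fin d)) :=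
        lintegral_mono fun a ↦ aux_fiber d D a
    _ = ENNReal.ofReal ((√π)⁻¹ * ∫ a, |inner ℝ a D| / ‖a‖ ∂(stdGaussian (EuclideanSpace ℝ (Fin d)))) := by
        rw [← integral_const_mul, ofReal_integral_eq_lintegral_ofReal (h1.const_mul _)]
        exact Filter.Eventually.of_forall fun a ↦ by positivity
    _ ≤ _ := by gcongr

open ProbabilityTheory in
lemma aux_rot (d : ℕ) (hd : 2 ≤ d) (D : EuclideanSpace ℝ (Fin d)) :
    ((stdGaussian (EuclideanSpace ℝ (Fin d))).prod (stdGaussian (EuclideanSpace ℝ (Fin d))))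
      {p | |inner ℝ (p.1 - p.2) (p.1 + p.2)| < |inner ℝ (p.1 - p.2) D|}
      ≤ ENNReal.ofReal ((√π)⁻¹ * (‖D‖ / √d)) := by
  set g := stdGaussian (EuclideanSpace ℝ (Fin d))
  have hr : (g.prod g).map (ContinuousLinearMap.rotation (-(π/4))) = g.prod g :=
    IsGaussian.map_rotation_eq_self_of_forall_strongDual_eq_zero
      (fun L ↦ integral_strongDual_stdGaussian L) _
  refine le_trans (le_of_eq ?_) (aux_core d hd D)
  conv_rhs => rw [← hr, Measure.map_apply (by fun_prop)
    (measurableSet_lt (by fun_prop) (by fun_prop))]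
  congr 1
  ext p
  have h2 : √2 * √2 = 2 := Real.mul_self_sqrt (by norm_num)
  have e1 : (√2/2) • p.1 + (-(√2/2)) • p.2 = (√2/2) • (p.1 - p.2) := by module
  have e2 : (√2/2) • p.1 + (√2/2) • p.2 = (√2/2) • (p.1 + p.2) := by module
  simp only [Set.mem_ofPred_eq, Set.mem_preimage, ContinuousLinearMap.rotation_apply, Real.cos_neg,
    Real.sin_neg, Real.cos_pi_div_four, Real.sin_pi_div_four, neg_neg, e1, e2, inner_smul_left,
    inner_smul_right, conj_trivial, abs_mul]
  rw [abs_of_pos (show 0 < √2/2 by positivity)]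
  have : √2 * (√2 / 2 * (√2 / 2 * |inner ℝ (p.1 - p.2) (p.1 + p.2)|)) = 
    √2 / 2 * |inner ℝ (p.1 - p.2) (p.1 + p.2)| := by
    linear_combination (√2 / 4 * |inner ℝ (p.1 - p.2) (p.1 + p.2)|) * h2
  rw [this, mul_lt_mul_iff_right₀ (by positivity)]

lemma aux_gamma (d : ℕ) (hd : 2 ≤ d) :
    (√π)⁻¹ * (√d)⁻¹ ≤ (4 / ((d : ℝ) - 1)) *
          (Real.Gamma ((d : ℝ) / 2) / (Real.pi * Real.Gamma (((d : ℝ) - 1) / 2))) := by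
  have hd' : (2 : ℝ) ≤ d := by exact_mod_cast hd
  have h1 : Real.Gamma (((d:ℝ) + 1) / 2) = ((d:ℝ) - 1) / 2 * Real.Gamma (((d:ℝ) - 1) / 2) := by
    rw [← Real.Gamma_add_one (by linarith)]; ring_nf
  have h2 : Real.Gamma (((d:ℝ) + 1) / 2) ≤ √(d / 2) * Real.Gamma ((d:ℝ) / 2) := by
    have := Real.Gamma_mul_add_mul_le_rpow_Gamma_mul_rpow_Gamma (s := (d:ℝ)/2) (t := (d:ℝ)/2 + 1)
      (a := 1/2) (b := 1/2) (by linarith) (by linarith) (by norm_num) (by norm_num) (by norm_num)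
    rw [Real.Gamma_add_one (by linarith), ← Real.sqrt_eq_rpow, ← Real.sqrt_eq_rpow,
      Real.sqrt_mul (by linarith), mul_left_comm,
      Real.mul_self_sqrt (Real.Gamma_pos_of_pos (by linarith)).le] at this
    convert this using 2
    ring
  have g0 : 0 < Real.Gamma ((d:ℝ) / 2) := Real.Gamma_pos_of_pos (by linarith)
  have g1 : 0 < Real.Gamma (((d:ℝ) - 1) / 2) := Real.Gamma_pos_of_pos (by linarith)
  have g2 : 0 < Real.Gamma (((d:ℝ) + 1) / 2) := Real.Gamma_pos_of_pos (by linarith)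
  have h3 : (4 / ((d : ℝ) - 1)) *
          (Real.Gamma ((d : ℝ) / 2) / (Real.pi * Real.Gamma (((d : ℝ) - 1) / 2)))
        = 2 * Real.Gamma ((d : ℝ) / 2) / (π * Real.Gamma (((d:ℝ) + 1) / 2)) := by
    rw [h1]
    have : (d:ℝ) - 1 ≠ 0 := by linarith
    field_simp
    norm_num
  rw [h3, le_div_iff₀ (by positivity), ← mul_inv, inv_mul_le_iff₀ (by positivity)]
  have h4 : √(d/2 : ℝ) = √d / √2 := Real.sqrt_div (by linarith) _
  rw [h4] at h2
  have h5 : √π * √π = π := Real.mul_self_sqrt pi_pos.le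
  have h6 : √π ≤ 2 := by
    rw [Real.sqrt_le_left (by norm_num)]; linarith [Real.pi_le_four]
  have h7 : 1 ≤ √2 := by rw [Real.one_le_sqrt]; norm_num
  have hd1 : 0 < √(d:ℝ) := by positivity
  calc π * Gamma ((d + 1) / 2) ≤ π * (√d / √2 * Gamma (d/2)) := by gcongr
    _ = √π * √d * ((√π / √2) * Gamma (d/2)) := by rw [← h5]; simp; ring
    _ ≤ √π * √d * (2 * Gamma (d/2)) := by
      gcongr
      exact (div_le_self (by positivity) h7).trans h6

open scoped MatrixOrder Matrix.Norms.L2Operator in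
lemma aux_factor (d : ℕ) (S : Matrix (Fin d) (Fin d) ℝ) (hS : S.PosDef) :
    ∃ A : Matrix (Fin d) (Fin d) ℝ, A.det ≠ 0 ∧ S = A * Aᵀ := by
  obtain ⟨y, hy, h⟩ := CStarAlgebra.isStrictlyPositive_iff_eq_star_mul_self.mp
        hS.isStrictlyPositive
  refine ⟨yᵀ, ?_, ?_⟩
  · rw [det_transpose]
    exact ((Matrix.isUnit_iff_isUnit_det _).1 hy).ne_zero
  · rw [h]; simp [star_eq_conjTranspose, conjTranspose_eq_transpose_of_trivial]

lemma aux_inv (d : ℕ) (A : Matrix (Fin d) (Fin d) ℝ) (hA : A.det ≠ 0) :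
    Aᵀ * ((A * Aᵀ)⁻¹ * A) = 1 := by
  have h1 : IsUnit A.det := isUnit_iff_ne_zero.2 hA
  have h2 : IsUnit Aᵀ.det := by rwa [det_transpose]
  rw [Matrix.mul_inv_rev, Matrix.mul_assoc, Matrix.nonsing_inv_mul _ h1, Matrix.mul_one,
    Matrix.mul_nonsing_inv _ h2]

lemma aux_dot (d : ℕ) (A : Matrix (Fin d) (Fin d) ℝ) (hA : A.det ≠ 0) (u v : Fin d → ℝ) :
    (A *ᵥ u) ⬝ᵥ ((A * Aᵀ)⁻¹ *ᵥ (A *ᵥ v)) = u ⬝ᵥ v := by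
  rw [mulVec_mulVec, ← vecMul_transpose, ← dotProduct_mulVec, mulVec_mulVec, aux_inv d A hA,
    one_mulVec]

lemma aux_pref (d : ℕ) (A : Matrix (Fin d) (Fin d) ℝ) (hA : A.det ≠ 0) (θ m u v : Fin d → ℝ) :
    gaussPref d (A * Aᵀ) θ ((A * Aᵀ) *ᵥ m + A *ᵥ u) ((A * Aᵀ) *ᵥ m + A *ᵥ v)
      = (u - v) ⬝ᵥ (Aᵀ *ᵥ (θ - m) - (2:ℝ)⁻¹ • (u + v)) := by
  have h0 : (A * Aᵀ)⁻¹ * (A * Aᵀ) = 1 := by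
    apply Matrix.nonsing_inv_mul
    simp [hA]
  have h1 : (A * Aᵀ) *ᵥ m + A *ᵥ u - ((A * Aᵀ) *ᵥ m + A *ᵥ v) = A *ᵥ (u - v) := by
    rw [mulVec_sub]; abel
  have h2 : (2:ℝ)⁻¹ • ((A * Aᵀ) *ᵥ m + A *ᵥ u + ((A * Aᵀ) *ᵥ m + A *ᵥ v))
      = (A * Aᵀ) *ᵥ m + A *ᵥ ((2:ℝ)⁻¹ • (u + v)) := by
    rw [mulVec_smul, mulVec_add]; module
  rw [gaussPref, h1, h2, mulVec_add, mulVec_mulVec m, h0, one_mulVec, ← sub_sub, dotProduct_sub,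
    aux_dot d A hA, ← vecMul_transpose, ← dotProduct_mulVec, dotProduct_sub (u - v)]

lemma aux_dens (d : ℕ) (A : Matrix (Fin d) (Fin d) ℝ) (hA : A.det ≠ 0) (θ m u : Fin d → ℝ) :
    gaussDensityNat d (A * Aᵀ) θ ((A * Aᵀ) *ᵥ m + A *ᵥ u)
      = (√((2 * π) ^ d))⁻¹ * |A.det|⁻¹ *
        Real.exp (-((u - Aᵀ *ᵥ (θ - m)) ⬝ᵥ (u - Aᵀ *ᵥ (θ - m))) / 2) := by
  have h1 : (A * Aᵀ) *ᵥ m + A *ᵥ u - (A * Aᵀ) *ᵥ θ = A *ᵥ (u - Aᵀ *ᵥ (θ - m)) := by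
    rw [mulVec_sub, mulVec_mulVec, mulVec_sub]; abel
  rw [gaussDensityNat, h1, aux_dot d A hA, det_mul, det_transpose, Real.sqrt_mul (by positivity),
    Real.sqrt_mul_self_eq_abs, mul_inv]

lemma aux_F (d : ℕ) (A : Matrix (Fin d) (Fin d) ℝ) (hA : A.det ≠ 0) (θ₁ θ₂ u : Fin d → ℝ) :
    gaussDensityNat d (A * Aᵀ) θ₁ ((A * Aᵀ) *ᵥ ((2:ℝ)⁻¹ • (θ₁ + θ₂)) + A *ᵥ u) *
    gaussDensityNat d (A * Aᵀ) θ₂ ((A * Aᵀ) *ᵥ ((2:ℝ)⁻¹ • (θ₁ + θ₂)) + A *ᵥ u)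
      ≤ ((√((2 * π) ^ d))⁻¹ * |A.det|⁻¹ * Real.exp (-(u ⬝ᵥ u) / 2)) ^ 2 := by
  rw [aux_dens d A hA, aux_dens d A hA, mul_pow _ (rexp _), ← Real.exp_nat_mul, mul_mul_mul_comm, ← sq,
    ← Real.exp_add]
  have e1 : Aᵀ *ᵥ (θ₁ - (2:ℝ)⁻¹ • (θ₁ + θ₂)) = (2:ℝ)⁻¹ • (Aᵀ *ᵥ (θ₁ - θ₂)) := by
    rw [← mulVec_smul]; congr 1; module
  have e2 : Aᵀ *ᵥ (θ₂ - (2:ℝ)⁻¹ • (θ₁ + θ₂)) = -((2:ℝ)⁻¹ • (Aᵀ *ᵥ (θ₁ - θ₂))) := by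
    rw [← mulVec_smul, ← mulVec_neg]; congr 1; module
  rw [e1, e2]
  set D := (2:ℝ)⁻¹ • (Aᵀ *ᵥ (θ₁ - θ₂))
  have hD : 0 ≤ D ⬝ᵥ D := by
    simpa using dotProduct_star_self_nonneg D
  gcongr
  simp only [dotProduct_sub, sub_dotProduct, dotProduct_neg, neg_dotProduct, dotProduct_comm D u]
  push_cast
  linarith

lemma aux_dens_nonneg (d : ℕ) (S : Matrix (Fin d) (Fin d) ℝ) (θ x : Fin d → ℝ) :
    0 ≤ gaussDensityNat d S θ x := by
  rw [gaussDensityNat]; positivity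

open ProbabilityTheory in
lemma aux_pi (d : ℕ) :
    Measure.pi (fun _ : Fin d ↦ gaussianReal 0 1) = (volume : Measure (Fin d → ℝ)).withDensity
      (fun u ↦ ENNReal.ofReal ((√((2 * π) ^ d))⁻¹ * Real.exp (-(u ⬝ᵥ u) / 2))) := by
  have hp : ∀ u : Fin d → ℝ, (√((2 * π) ^ d))⁻¹ * Real.exp (-(u ⬝ᵥ u) / 2)
      = ∏ i, gaussianPDFReal 0 1 (u i) := by
    intro u
    simp only [gaussianPDFReal, Finset.prod_mul_distrib, ← Real.exp_sum]
    congr 1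
    · rw [Finset.prod_const, Finset.card_univ, Fintype.card_fin, inv_pow]
      congr 1
      rw [Real.sqrt_eq_iff_mul_self_eq (by positivity) (by positivity), ← mul_pow,
        Real.mul_self_sqrt (by positivity)]
      simp
    · simp [dotProduct, Finset.sum_div, neg_div, sq]
  simp_rw [hp]
  refine Measure.pi_eq fun s hs ↦ ?_
  rw [withDensity_apply _ (MeasurableSet.univ_pi hs), volume_pi, Measure.restrict_pi_pi,
    ← ofReal_integral_eq_lintegral_ofReal, integral_fintype_prod_eq_prod,
    ENNReal.ofReal_prod_of_nonneg]
  · refine Finset.prod_congr rfl fun i _ ↦ ?_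
    rw [gaussianReal_apply_eq_integral _ one_ne_zero]
  · intro i _
    exact integral_nonneg fun x ↦ gaussianPDFReal_nonneg _ _ _
  · exact Integrable.fintype_prod fun i ↦ (integrable_gaussianPDFReal 0 1).restrict
  · exact Filter.Eventually.of_forall fun x ↦ Finset.prod_nonneg fun i _ ↦
      gaussianPDFReal_nonneg _ _ _

lemma aux_set (d : ℕ) (A : Matrix (Fin d) (Fin d) ℝ) (hA : A.det ≠ 0) (θ₁ θ₂ u v : Fin d → ℝ) :
    (gaussPref d (A * Aᵀ) θ₁ ((A * Aᵀ) *ᵥ ((2:ℝ)⁻¹ • (θ₁ + θ₂)) + A *ᵥ u)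
        ((A * Aᵀ) *ᵥ ((2:ℝ)⁻¹ • (θ₁ + θ₂)) + A *ᵥ v) *
      gaussPref d (A * Aᵀ) θ₂ ((A * Aᵀ) *ᵥ ((2:ℝ)⁻¹ • (θ₁ + θ₂)) + A *ᵥ u)
        ((A * Aᵀ) *ᵥ ((2:ℝ)⁻¹ • (θ₁ + θ₂)) + A *ᵥ v) < 0) ↔
      |(u - v) ⬝ᵥ (u + v)| < |(u - v) ⬝ᵥ (Aᵀ *ᵥ (θ₁ - θ₂))| := by
  rw [aux_pref d A hA, aux_pref d A hA]
  have e1 : Aᵀ *ᵥ (θ₁ - (2:ℝ)⁻¹ • (θ₁ + θ₂)) = (2:ℝ)⁻¹ • (Aᵀ *ᵥ (θ₁ - θ₂)) := by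
    rw [← mulVec_smul]; congr 1; module
  have e2 : Aᵀ *ᵥ (θ₂ - (2:ℝ)⁻¹ • (θ₁ + θ₂)) = -((2:ℝ)⁻¹ • (Aᵀ *ᵥ (θ₁ - θ₂))) := by
    rw [← mulVec_smul, ← mulVec_neg]; congr 1; module
  rw [e1, e2, dotProduct_sub, dotProduct_sub, dotProduct_neg, dotProduct_smul, dotProduct_smul,
    ← sq_lt_sq]
  simp only [smul_eq_mul]
  constructor <;> intro h <;> nlinarith

open ProbabilityTheory in
lemma aux_pi_bound (d : ℕ) (hd : 2 ≤ d) (D : Fin d → ℝ) :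
    ((Measure.pi (fun _ : Fin d ↦ gaussianReal 0 1)).prod
      (Measure.pi (fun _ : Fin d ↦ gaussianReal 0 1)))
      {p | |(p.1 - p.2) ⬝ᵥ (p.1 + p.2)| < |(p.1 - p.2) ⬝ᵥ D|}
      ≤ ENNReal.ofReal ((√π)⁻¹ * (√(D ⬝ᵥ D) / √d)) := by
  have h := aux_rot d hd (WithLp.toLp 2 D)
  have hn : ‖(WithLp.toLp 2 D : EuclideanSpace ℝ (Fin d))‖ = √(D ⬝ᵥ D) := by
    rw [EuclideanSpace.norm_eq]; simp [dotProduct, sq]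
  rw [hn, ← map_pi_eq_stdGaussian, Measure.map_prod_map _ _ (by fun_prop) (by fun_prop),
    Measure.map_apply (by fun_prop) (measurableSet_lt (by fun_prop) (by fun_prop))] at h
  refine le_trans (le_of_eq ?_) h
  congr 1
  ext p
  simp only [Set.mem_ofPred_eq, Set.mem_preimage, Prod.map, ← WithLp.toLp_sub, ← WithLp.toLp_add,
    EuclideanSpace.inner_toLp_toLp, star_trivial]
  rw [dotProduct_comm, dotProduct_comm (p.1 - p.2) D]

lemma aux_vol (d : ℕ) (A : Matrix (Fin d) (Fin d) ℝ) (hA : A.det ≠ 0) (m : Fin d → ℝ) :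
    (volume : Measure (Fin d → ℝ)) = Measure.map (fun u ↦ m + A *ᵥ u)
      ((volume : Measure (Fin d → ℝ)).withDensity (fun _ ↦ ENNReal.ofReal |A.det|)) := by
  have h := Real.map_matrix_volume_pi_eq_smul_volume_pi hA
  have hmeas : Measurable (toLin' A) := (LinearMap.continuous_on_pi _).measurable
  have hc : (fun u ↦ m + A *ᵥ u) = (fun x ↦ m + x) ∘ (toLin' A) := by
    ext u; simp
  rw [withDensity_const, Measure.map_smul, hc, ← Measure.map_map (by fun_prop) hmeas, h,
    Measure.map_smul, smul_smul, ← ENNReal.ofReal_mul (abs_nonneg _), ← abs_mul,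
    mul_inv_cancel₀ hA, abs_one, ENNReal.ofReal_one, one_smul]
  exact (measurePreserving_add_left volume m).map_eq.symm

lemma aux_main (d : ℕ) (hd : 2 ≤ d) (A : Matrix (Fin d) (Fin d) ℝ) (hA : A.det ≠ 0)
    (θ₁ θ₂ : Fin d → ℝ) :
    (∫⁻ w in {w : (Fin d → ℝ) × (Fin d → ℝ) |
          gaussPref d (A * Aᵀ) θ₁ w.1 w.2 * gaussPref d (A * Aᵀ) θ₂ w.1 w.2 < 0},
        ENNReal.ofReal (√(gaussDensityNat d (A * Aᵀ) θ₁ w.1 * gaussDensityNat d (A * Aᵀ) θ₁ w.2 *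
          (gaussDensityNat d (A * Aᵀ) θ₂ w.1 * gaussDensityNat d (A * Aᵀ) θ₂ w.2))))
      ≤ ENNReal.ofReal ((√π)⁻¹ *
        (√((Aᵀ *ᵥ (θ₁ - θ₂)) ⬝ᵥ (Aᵀ *ᵥ (θ₁ - θ₂))) / √d)) := by
  have hcm : ∀ B : Matrix (Fin d) (Fin d) ℝ, Measurable (fun u : Fin d → ℝ ↦ B *ᵥ u) := fun B ↦
    (LinearMap.continuous_on_pi (toLin' B)).measurable
  have hdm : ∀ θ, Measurable (gaussDensityNat d (A * Aᵀ) θ) := by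
    intro θ
    unfold gaussDensityNat dotProduct
    have := hcm (A * Aᵀ)⁻¹
    have h2 : Measurable (fun x : Fin d → ℝ ↦ (A * Aᵀ)⁻¹ *ᵥ (x - (A * Aᵀ) *ᵥ θ)) :=
      this.comp (by fun_prop)
    fun_prop
  have hpm : ∀ θ, Measurable
      (fun w : (Fin d → ℝ) × (Fin d → ℝ) ↦ gaussPref d (A * Aᵀ) θ w.1 w.2) := by
    intro θ
    unfold gaussPref dotProduct
    have := hcm (A * Aᵀ)⁻¹
    have h2 : Measurable (fun w : (Fin d → ℝ) × (Fin d → ℝ) ↦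
      (A * Aᵀ)⁻¹ *ᵥ ((2 : ℝ)⁻¹ • (w.1 + w.2))) :=
      this.comp (by fun_prop)
    fun_prop
  have hF : Measurable (fun w : (Fin d → ℝ) × (Fin d → ℝ) ↦
      ENNReal.ofReal (√(gaussDensityNat d (A * Aᵀ) θ₁ w.1 * gaussDensityNat d (A * Aᵀ) θ₁ w.2 *
          (gaussDensityNat d (A * Aᵀ) θ₂ w.1 * gaussDensityNat d (A * Aᵀ) θ₂ w.2)))) := by
    have h1 := hdm θ₁
    have h2 := hdm θ₂
    fun_prop
  have hs : MeasurableSet {w : (Fin d → ℝ) × (Fin d → ℝ) |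
          gaussPref d (A * Aᵀ) θ₁ w.1 w.2 * gaussPref d (A * Aᵀ) θ₂ w.1 w.2 < 0} :=
    measurableSet_lt ((hpm θ₁).mul (hpm θ₂)) measurable_const
  set m := (A * Aᵀ) *ᵥ ((2:ℝ)⁻¹ • (θ₁ + θ₂)) with hm
  have hT : Measurable (fun u : Fin d → ℝ ↦ m + A *ᵥ u) := (hcm A).const_add m
  rw [Measure.volume_eq_prod, aux_vol d A hA m, Measure.map_prod_map _ _ hT hT,
    setLIntegral_map hs hF (hT.prodMap hT), prod_withDensity measurable_const measurable_const]
  have hmd : Measurable (fun u : Fin d → ℝ ↦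
      ENNReal.ofReal ((√((2 * π) ^ d))⁻¹ * Real.exp (-(u ⬝ᵥ u) / 2))) := by
    unfold dotProduct; fun_prop
  refine le_trans ?_ (aux_pi_bound d hd (Aᵀ *ᵥ (θ₁ - θ₂)))
  have hset : (Prod.map (fun u : Fin d → ℝ ↦ m + A *ᵥ u) (fun u : Fin d → ℝ ↦ m + A *ᵥ u)) ⁻¹'
      {w : (Fin d → ℝ) × (Fin d → ℝ) |
          gaussPref d (A * Aᵀ) θ₁ w.1 w.2 * gaussPref d (A * Aᵀ) θ₂ w.1 w.2 < 0}
      = {p | |(p.1 - p.2) ⬝ᵥ (p.1 + p.2)| < |(p.1 - p.2) ⬝ᵥ (Aᵀ *ᵥ (θ₁ - θ₂))|} := by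
    ext p
    exact aux_set d A hA θ₁ θ₂ p.1 p.2
  have hs' := (hT.prodMap hT) hs
  rw [hset] at hs' ⊢
  rw [aux_pi, prod_withDensity hmd hmd, withDensity_apply _ hs', withDensity_const,
    Measure.restrict_smul, lintegral_smul_measure, smul_eq_mul, ← lintegral_const_mul _ ?_]
  · refine lintegral_mono fun p ↦ ?_
    simp only [Prod.map]
    have hK : 0 < |A.det| := abs_pos.2 hA
    rw [← ENNReal.ofReal_mul (abs_nonneg _), ← ENNReal.ofReal_mul (by positivity),
      ← ENNReal.ofReal_mul (by positivity)]
    refine ENNReal.ofReal_le_ofReal ?_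
    have f1 := aux_F d A hA θ₁ θ₂ p.1
    have f2 := aux_F d A hA θ₁ θ₂ p.2
    rw [← hm] at f1 f2
    have f3 := mul_le_mul f1 f2 (mul_nonneg (aux_dens_nonneg _ _ _ _) (aux_dens_nonneg _ _ _ _))
      (sq_nonneg _)
    rw [← mul_pow, mul_mul_mul_comm] at f3
    have f4 := (Real.sqrt_le_left (by positivity)).2 f3
    calc _ ≤ |A.det| * |A.det| * _ := mul_le_mul_of_nonneg_left f4 (by positivity)
      _ = _ := by field_simp
  · exact hF.comp (hT.prodMap hT)

/-- **Hellinger control of the disagreement Bhattacharyya mass for Gaussians.**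
The Bhattacharyya mass `B̃C(θ*,θ)` of the disagreement set
`D(θ*,θ) = {ℓ_{θ*}·ℓ_θ < 0}` is at most
`(4/(d−1)) (Γ(d/2)/(π Γ((d−1)/2))) ‖θ* − θ‖_Σ`. -/
theorem stmt11 (d : ℕ) (hd : 2 ≤ d) (S : Matrix (Fin d) (Fin d) ℝ) (hS : S.PosDef)
    (θstar θ : Fin d → ℝ) :
    (∫ w in {w : (Fin d → ℝ) × (Fin d → ℝ) |
          gaussPref d S θstar w.1 w.2 * gaussPref d S θ w.1 w.2 < 0},
        Real.sqrt (gaussDensityNat d S θstar w.1 * gaussDensityNat d S θstar w.2 *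
          (gaussDensityNat d S θ w.1 * gaussDensityNat d S θ w.2)))
      ≤ (4 / ((d : ℝ) - 1)) *
          (Real.Gamma ((d : ℝ) / 2) / (Real.pi * Real.Gamma (((d : ℝ) - 1) / 2))) *
          Real.sqrt ((θstar - θ) ⬝ᵥ (S *ᵥ (θstar - θ))) := by
  
  obtain ⟨A, hA, rfl⟩ := aux_factor d S hS
  have h := aux_main d hd A hA θstar θ
  have hq : (θstar - θ) ⬝ᵥ ((A * Aᵀ) *ᵥ (θstar - θ))
      = (Aᵀ *ᵥ (θstar - θ)) ⬝ᵥ (Aᵀ *ᵥ (θstar - θ)) := by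
    rw [← mulVec_mulVec, dotProduct_mulVec, ← mulVec_transpose]
  rw [hq]
  set Q := √((Aᵀ *ᵥ (θstar - θ)) ⬝ᵥ (Aᵀ *ᵥ (θstar - θ)))
  have hQ : 0 ≤ Q := Real.sqrt_nonneg _
  have hb : (√π)⁻¹ * (Q / √d) ≤ (4 / ((d : ℝ) - 1)) *
      (Real.Gamma ((d : ℝ) / 2) / (Real.pi * Real.Gamma (((d : ℝ) - 1) / 2))) * Q := by
    calc _ = (√π)⁻¹ * (√d)⁻¹ * Q := by ring
      _ ≤ _ := mul_le_mul_of_nonneg_right (aux_gamma d hd) hQ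
  refine le_trans ?_ hb
  by_cases hi : IntegrableOn (fun w : (Fin d → ℝ) × (Fin d → ℝ) ↦
      √(gaussDensityNat d (A * Aᵀ) θstar w.1 * gaussDensityNat d (A * Aᵀ) θstar w.2 *
          (gaussDensityNat d (A * Aᵀ) θ w.1 * gaussDensityNat d (A * Aᵀ) θ w.2)))
      {w : (Fin d → ℝ) × (Fin d → ℝ) |
          gaussPref d (A * Aᵀ) θstar w.1 w.2 * gaussPref d (A * Aᵀ) θ w.1 w.2 < 0}
  · rw [integral_eq_lintegral_of_nonneg_ae (Filter.Eventually.of_forall fun _ ↦ Real.sqrt_nonneg _)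
      hi.aestronglyMeasurable]
    exact ENNReal.toReal_le_of_le_ofReal (by positivity) h
  · rw [integral_undef hi]; positivity
end

section
/- Let θ ∈ ℝ and b > 0, and let X, Y be independent real random variables each with the Laplace density p_{θ,b}(x) = (1/(2b)) exp(−|x − θ|/b). Then P( min(X,Y) ≤ θ ≤ max(X,Y) and (X + Y)/2 > θ ) = 1/4. -/
open MeasureTheory

/-- The Laplace distribution `Lap(θ, b)` on `ℝ`, defined through its density
`x ↦ (1/(2b)) exp(−|x − θ|/b)` with respect to Lebesgue measure. -/
noncomputable def laplaceMeasure (θ b : ℝ) : Measure ℝ :=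
  volume.withDensity fun x => ENNReal.ofReal ((1 / (2 * b)) * Real.exp (-|x - θ| / b))


instance lap_sf (θ b : ℝ) : SFinite (laplaceMeasure θ b) := by
  unfold laplaceMeasure; infer_instance

lemma lap_meas (θ b : ℝ) : Measurable fun x : ℝ =>
    ENNReal.ofReal ((1 / (2 * b)) * Real.exp (-|x - θ| / b)) := by fun_prop

lemma lap_ac (θ b : ℝ) : laplaceMeasure θ b ≪ volume := withDensity_absolutelyContinuous _ _

lemma lap_refl (θ b : ℝ) :
    MeasurePreserving (fun x => 2 * θ - x) (laplaceMeasure θ b) (laplaceMeasure θ b) := by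
  have hm : Measurable (fun x : ℝ => 2 * θ - x) := by fun_prop
  refine ⟨hm, ?_⟩
  ext s hs
  rw [Measure.map_apply hm hs]
  unfold laplaceMeasure
  rw [withDensity_apply _ hs, withDensity_apply _ (hm hs)]
  have h := (Measure.measurePreserving_sub_left (volume : Measure ℝ) (2 * θ)).setLIntegral_comp_preimage
    hs (lap_meas θ b)
  rw [← h]
  congr 1
  ext x
  have : |2 * θ - x - θ| = |x - θ| := by
    rw [← abs_neg]; congr 1; ring
  simp only [this]

lemma lap_Ioi (θ b : ℝ) (hb : 0 < b) : laplaceMeasure θ b (Set.Ioi θ) = 1 / 2 := by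
  unfold laplaceMeasure
  rw [withDensity_apply _ measurableSet_Ioi]
  have h1 : ∫⁻ x in Set.Ioi θ, ENNReal.ofReal ((1 / (2 * b)) * Real.exp (-|x - θ| / b))
      = ∫⁻ x in Set.Ioi θ, ENNReal.ofReal
        ((1 / (2 * b) * Real.exp (θ / b)) * Real.exp ((-1 / b) * x)) := by
    refine setLIntegral_congr_fun measurableSet_Ioi fun x hx => ?_
    have hx : θ < x := hx
    rw [abs_of_pos (by linarith), mul_assoc, ← Real.exp_add]
    congr 3
    field_simp
    ring_nf
  have hneg : -1 / b < 0 := by apply div_neg_of_neg_of_pos <;> linarith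
  rw [h1, ← ofReal_integral_eq_lintegral_ofReal, integral_const_mul, integral_exp_mul_Ioi hneg]
  · have : 1 / (2 * b) * Real.exp (θ / b) * (-Real.exp (-1 / b * θ) / (-1 / b)) = 1 / 2 := by
      have e : Real.exp (θ / b) * Real.exp (-1 / b * θ) = 1 := by
        rw [← Real.exp_add, Real.exp_eq_one_iff]; field_simp; ring
      calc _ = 1 / 2 * (Real.exp (θ / b) * Real.exp (-1 / b * θ)) := by field_simp
        _ = _ := by rw [e]; ring
    rw [this, ENNReal.ofReal_div_of_pos (by norm_num)]
    simp
  · exact (integrableOn_exp_mul_Ioi hneg θ).const_mul _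
  · exact Filter.Eventually.of_forall fun x => by positivity

lemma lap_Iio (θ b : ℝ) (hb : 0 < b) : laplaceMeasure θ b (Set.Iio θ) = 1 / 2 := by
  rw [← lap_Ioi θ b hb, ← (lap_refl θ b).measure_preimage measurableSet_Ioi.nullMeasurableSet]
  congr 1
  ext x
  simp only [Set.mem_Iio, Set.mem_preimage, Set.mem_Ioi]
  constructor <;> intro h <;> linarith

theorem stmt13 (θ b : ℝ) (hb : 0 < b) :
    ((laplaceMeasure θ b).prod (laplaceMeasure θ b))
        {w : ℝ × ℝ | (min w.1 w.2 ≤ θ ∧ θ ≤ max w.1 w.2) ∧ θ < (w.1 + w.2) / 2}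
      = 1 / 4 := by
  set μ := laplaceMeasure θ b with hμ
  set S := {w : ℝ × ℝ | (min w.1 w.2 ≤ θ ∧ θ ≤ max w.1 w.2) ∧ θ < (w.1 + w.2) / 2} with hS
  have hSm : MeasurableSet S := by
    have h1 : MeasurableSet {w : ℝ × ℝ | min w.1 w.2 ≤ θ} :=
      measurableSet_le (by fun_prop) (by fun_prop)
    have h2 : MeasurableSet {w : ℝ × ℝ | θ ≤ max w.1 w.2} :=
      measurableSet_le (by fun_prop) (by fun_prop)
    have h3 : MeasurableSet {w : ℝ × ℝ | θ < (w.1 + w.2) / 2} :=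
      measurableSet_lt (by fun_prop) (by fun_prop)
    exact (h1.inter h2).inter h3
  have hr : MeasurePreserving (Prod.map (fun x => 2 * θ - x) (fun x => 2 * θ - x))
      (μ.prod μ) (μ.prod μ) := (lap_refl θ b).prod (lap_refl θ b)
  set r : ℝ × ℝ → ℝ × ℝ := Prod.map (fun x => 2 * θ - x) (fun x => 2 * θ - x) with hrdef
  have hrS := hr.measure_preimage hSm.nullMeasurableSet
  have hac : μ.prod μ ≪ (volume : Measure (ℝ × ℝ)) := by
    rw [Measure.volume_eq_prod]
    exact (lap_ac θ b).prod (lap_ac θ b)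
  have hne : ∀ c : ℝ, ∀ᵐ x : ℝ, x ≠ c := fun c => by
    simp [ae_iff]
  have hline : ∀ f : ℝ → ℝ, Measurable f → ∀ᵐ w : ℝ × ℝ, w.2 ≠ f w.1 := by
    intro f hf
    rw [Measure.volume_eq_prod]
    rw [Measure.ae_prod_iff_ae_ae]
    · exact Filter.Eventually.of_forall fun x => hne (f x)
    · exact (measurableSet_eq_fun (by fun_prop) (by fun_prop)).compl
  have a1 : ∀ᵐ w ∂(μ.prod μ), w.2 ≠ θ := hac.ae_le (hline (fun _ => θ) (by fun_prop))
  have a2 : ∀ᵐ w ∂(μ.prod μ), w.2 ≠ 2 * θ - w.1 :=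
    hac.ae_le (hline (fun x => 2 * θ - x) (by fun_prop))
  have a3 : ∀ᵐ w ∂(μ.prod μ), w.1 ≠ θ :=
    Measure.quasiMeasurePreserving_fst.ae ((lap_ac θ b).ae_le (hne θ))
  have hU : (S ∪ r ⁻¹' S : Set (ℝ × ℝ)) =ᵐ[μ.prod μ]
      ((Set.Iio θ ×ˢ Set.Ioi θ) ∪ (Set.Ioi θ ×ˢ Set.Iio θ) : Set (ℝ × ℝ)) := by
    rw [Filter.eventuallyEq_set]
    filter_upwards [a1, a2, a3] with w h1 h2 h3
    obtain ⟨x, y⟩ := w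
    simp only [hS, hrdef, Set.mem_union, Set.mem_preimage, Set.mem_setOf_eq, Prod.map,
      Set.mem_prod, Set.mem_Iio, Set.mem_Ioi, min_le_iff, le_max_iff] at *
    grind
  have hm := measure_congr hU
  rw [measure_union _ (hr.measurable hSm), hrS, measure_union _
    (measurableSet_Ioi.prod measurableSet_Iio), Measure.prod_prod, Measure.prod_prod,
    hμ, lap_Ioi θ b hb, lap_Iio θ b hb, ← hμ] at hm
  · have hfin : (μ.prod μ) S ≠ ⊤ := by
      intro h
      rw [h] at hm
      have := congrArg ENNReal.toReal hm
      have h2 : (1 / 2 * (1 / 2) + 1 / 2 * (1 / 2) : ENNReal) ≠ ⊤ := by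
        finiteness
      simp only [top_add] at hm
      exact h2 hm.symm
    have h := congrArg ENNReal.toReal hm
    rw [ENNReal.toReal_add hfin hfin, ENNReal.toReal_add (by finiteness) (by finiteness)] at h
    rw [← ENNReal.toReal_eq_toReal_iff' hfin (by finiteness)]
    simp at h ⊢
    linarith
  · rw [Set.disjoint_left]
    rintro ⟨x, y⟩ h1 h2
    simp at h1 h2
    linarith [h1.1, h2.1]
  · rw [Set.disjoint_left]
    rintro ⟨x, y⟩ h1 h2
    have e1 := h1.2
    have e2 := h2.2
    simp [hrdef] at e1 e2
    linarith
end

section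
/- For θ ∈ ℝ define ℓ_θ : ℝ² → ℝ by ℓ_θ(x,y) = |y − θ| − |x − θ|. Let θ*, θ ∈ ℝ with θ ≠ θ*. Then the set D̃(θ*, θ) := {(x,y) ∈ ℝ² : min(x,y) ≤ θ* ≤ max(x,y) and 0 < sign(θ − θ*) · ((x+y)/2 − θ*) < |θ − θ*|} satisfies D̃(θ*, θ) = {(x,y) ∈ ℝ² : min(x,y) ≤ θ* ≤ max(x,y)} ∩ {(x,y) ∈ ℝ² : ℓ_{θ*}(x,y) · ℓ_θ(x,y) < 0}; in particular D̃(θ*, θ) ⊆ {(x,y) : ℓ_{θ*}(x,y) · ℓ_θ(x,y) < 0}. -/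
lemma aux_pos (x y a : ℝ) (hxy : x < y) : 0 < |y - a| - |x - a| ↔ a < (x + y) / 2 := by
  constructor <;> intro h <;> cases abs_cases (y - a) <;> cases abs_cases (x - a) <;> linarith

lemma aux_neg (x y a : ℝ) (hxy : x < y) : |y - a| - |x - a| < 0 ↔ (x + y) / 2 < a := by
  constructor <;> intro h <;> cases abs_cases (y - a) <;> cases abs_cases (x - a) <;> linarith

lemma aux_mul (x y t a : ℝ) (hxy : x ≠ y) :
    (|y - t| - |x - t|) * (|y - a| - |x - a|) < 0 ↔
      (t < (x + y) / 2 ∧ (x + y) / 2 < a) ∨ ((x + y) / 2 < t ∧ a < (x + y) / 2) := by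
  rcases lt_or_gt_of_ne hxy with h | h
  · rw [mul_neg_iff, aux_pos x y t h, aux_pos x y a h, aux_neg x y t h, aux_neg x y a h]
  · have e : (|y - t| - |x - t|) * (|y - a| - |x - a|)
        = (|x - t| - |y - t|) * (|x - a| - |y - a|) := by ring
    rw [e, mul_neg_iff, aux_pos y x t h, aux_pos y x a h, aux_neg y x t h, aux_neg y x a h,
      add_comm y x]

lemma aux_main_s16 (θstar θ : ℝ) (h : θ ≠ θstar) (x y : ℝ)
    (hG : min x y ≤ θstar ∧ θstar ≤ max x y) :
    (0 < Real.sign (θ - θstar) * ((x + y) / 2 - θstar) ∧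
          Real.sign (θ - θstar) * ((x + y) / 2 - θstar) < |θ - θstar|) ↔
      (|y - θstar| - |x - θstar|) * (|y - θ| - |x - θ|) < 0 := by
  by_cases hxy : x = y
  · subst hxy
    have : x = θstar := by simpa using le_antisymm (by simpa using hG.1) (by simpa using hG.2)
    subst this
    simp
  rw [aux_mul x y θstar θ hxy]
  rcases lt_or_gt_of_ne h with h | h
  · rw [Real.sign_of_neg (sub_neg.2 h), abs_of_neg (sub_neg.2 h)]
    constructor
    · rintro ⟨h1, h2⟩
      right
      constructor <;> linarith
    · rintro (⟨h1, h2⟩ | ⟨h1, h2⟩) <;> constructor <;> linarith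
  · rw [Real.sign_of_pos (sub_pos.2 h), abs_of_pos (sub_pos.2 h)]
    constructor
    · rintro ⟨h1, h2⟩
      left
      constructor <;> linarith
    · rintro (⟨h1, h2⟩ | ⟨h1, h2⟩) <;> constructor <;> linarith

/-- **Linearization identity for the Laplace disagreement set.**
With `ℓ_θ(x,y) = |y−θ| − |x−θ|`, the linearized disagreement set `D̃(θ*,θ)` equals the
intersection of the informative set `G₁(θ*) = {min(x,y) ≤ θ* ≤ max(x,y)}` with the
disagreement set `D(θ*,θ) = {ℓ_{θ*}·ℓ_θ < 0}`; in particular `D̃(θ*,θ) ⊆ D(θ*,θ)`. -/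
theorem stmt16 (θstar θ : ℝ) (h : θ ≠ θstar) :
    ({w : ℝ × ℝ | (min w.1 w.2 ≤ θstar ∧ θstar ≤ max w.1 w.2) ∧
          0 < Real.sign (θ - θstar) * ((w.1 + w.2) / 2 - θstar) ∧
          Real.sign (θ - θstar) * ((w.1 + w.2) / 2 - θstar) < |θ - θstar|}
        = {w : ℝ × ℝ | min w.1 w.2 ≤ θstar ∧ θstar ≤ max w.1 w.2} ∩
          {w : ℝ × ℝ | (|w.2 - θstar| - |w.1 - θstar|) * (|w.2 - θ| - |w.1 - θ|) < 0}) ∧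
      {w : ℝ × ℝ | (min w.1 w.2 ≤ θstar ∧ θstar ≤ max w.1 w.2) ∧
          0 < Real.sign (θ - θstar) * ((w.1 + w.2) / 2 - θstar) ∧
          Real.sign (θ - θstar) * ((w.1 + w.2) / 2 - θstar) < |θ - θstar|}
        ⊆ {w : ℝ × ℝ | (|w.2 - θstar| - |w.1 - θstar|) * (|w.2 - θ| - |w.1 - θ|) < 0} := by
  refine ⟨?_, ?_⟩
  · ext w
    exact and_congr_right fun hG => aux_main_s16 θstar θ h w.1 w.2 hG
  · rintro w ⟨hG, hw⟩
    exact (aux_main_s16 θstar θ h w.1 w.2 hG).1 hw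
end

section
/- Let d ≥ 2, let Σ be a d × d positive definite matrix, μ ∈ ℝ^d, θ* = Σ^{−1}μ, and let X, Y be independent random vectors each with distribution N(μ, Σ). Let u ∈ ℝ^d satisfy uᵀΣu = 1. Define, on the event G_1(θ*, u) = {⟨X − Y, θ* − Σ^{−1}(X+Y)/2⟩ · ⟨u, X − Y⟩ < 0}, the deviation V_{θ*,u}(X,Y) = ⟨X − Y, Σ^{−1}(X+Y)/2 − θ*⟩ / ⟨u, X − Y⟩. Then for every ε ≥ 0, P( G_1(θ*, u) and V_{θ*,u}(X,Y) ≤ ε ) = (1/2) · E_{U}[ erf( ε · |⟨Σ^{1/2} u, U⟩| ) ], where U is uniformly distributed on the unit Euclidean sphere S^{d−1} ⊆ ℝ^d and erf(t) = (2/√π) ∫_0^t e^{−s²} ds. -/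
open MeasureTheory Matrix Real
open scoped MatrixOrder

/-- The uniform distribution on the unit Euclidean sphere `S^{d−1} ⊆ ℝ^d`, i.e. the
normalized rotation-invariant surface measure. -/
noncomputable def uniformSphere (d : ℕ) :
    Measure (Metric.sphere (0 : EuclideanSpace ℝ (Fin d)) 1) :=
  (((volume : Measure (EuclideanSpace ℝ (Fin d))).toSphere) Set.univ)⁻¹ •
    ((volume : Measure (EuclideanSpace ℝ (Fin d))).toSphere)

/-- The error function `erf(t) = (2/√π) ∫_0^t e^{−s²} ds`. -/
noncomputable def erf (t : ℝ) : ℝ := (2 / Real.sqrt π) * ∫ s in (0 : ℝ)..t, Real.exp (-s ^ 2)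

open ProbabilityTheory in
lemma stdG_density (d : ℕ) : stdGaussian (EuclideanSpace ℝ (Fin d)) =
    (volume : Measure (EuclideanSpace ℝ (Fin d))).withDensity
      (fun x => ENNReal.ofReal ((Real.sqrt ((2 * π) ^ d))⁻¹ * Real.exp (-‖x‖ ^ 2 / 2))) := by
  have hint : Integrable (fun x : EuclideanSpace ℝ (Fin d) =>
      (Real.sqrt ((2 * π) ^ d))⁻¹ * Real.exp (-‖x‖ ^ 2 / 2)) := by
    apply Integrable.const_mul
    have := (GaussianFourier.integrable_cexp_neg_mul_sq_norm_add (V := EuclideanSpace ℝ (Fin d)) (b := 1/2) (by norm_num) 0 0).norm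
    refine this.congr (Filter.Eventually.of_forall fun x => ?_)
    simp only [Complex.norm_exp]
    congr 1
    simp
    norm_cast
    ring
  have : IsFiniteMeasure ((volume : Measure (EuclideanSpace ℝ (Fin d))).withDensity
      (fun x => ENNReal.ofReal ((Real.sqrt ((2 * π) ^ d))⁻¹ * Real.exp (-‖x‖ ^ 2 / 2)))) :=
    isFiniteMeasure_withDensity_ofReal hint.2
  apply Measure.ext_of_charFun
  ext t
  rw [charFun_stdGaussian, charFun_apply, integral_withDensity_eq_integral_toReal_smul (by fun_prop)
    (Filter.Eventually.of_forall fun _ => ENNReal.ofReal_lt_top)]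
  have h1 := GaussianFourier.integral_cexp_neg_mul_sq_norm_add (V := EuclideanSpace ℝ (Fin d)) (b := 1/2) (by norm_num) Complex.I t
  have h2 : ∀ x : EuclideanSpace ℝ (Fin d), (ENNReal.ofReal ((Real.sqrt ((2 * π) ^ d))⁻¹ * Real.exp (-‖x‖ ^ 2 / 2))).toReal • Complex.exp (inner ℝ x t * Complex.I) = ((Real.sqrt ((2 * π) ^ d))⁻¹ : ℂ) * Complex.exp (-(1/2) * (‖x‖:ℂ) ^ 2 + Complex.I * (inner ℝ t x : ℝ)) := by
    intro x
    rw [ENNReal.toReal_ofReal (by positivity), Complex.real_smul, Complex.exp_add, real_inner_comm]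
    push_cast
    rw [mul_assoc]
    congr 3
    · ring
    · ring
  simp_rw [h2]
  rw [integral_const_mul, h1]
  have h3 : ((π / (1/2) : ℂ)) ^ ((Module.finrank ℝ (EuclideanSpace ℝ (Fin d)) : ℂ) / 2) = ((Real.sqrt ((2 * π) ^ d) : ℝ) : ℂ) := by
    have : (π / (1/2) : ℂ) = ((2 * π : ℝ) : ℂ) := by push_cast; ring
    rw [this, finrank_euclideanSpace_fin, show ((d:ℂ)/2) = ((d/2 : ℝ) : ℂ) by push_cast; rfl,
      ← Complex.ofReal_cpow (by positivity)]
    congr 1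
    rw [Real.sqrt_eq_rpow, ← Real.rpow_natCast, ← Real.rpow_mul (by positivity)]
    ring_nf
  rw [h3, ← mul_assoc, inv_mul_cancel₀, one_mul]
  · congr 1
    simp
    ring
  · norm_cast
    positivity

open ProbabilityTheory in
lemma gauss_map (d : ℕ) (S A : Matrix (Fin d) (Fin d) ℝ) (hAt : Aᵀ = A) (hA : A * A = S)
    (hdet : A.det ≠ 0) (μv : Fin d → ℝ) :
    gaussMeasure d S μv =
      (stdGaussian (EuclideanSpace ℝ (Fin d))).map (fun x => μv + A *ᵥ x.ofLp) := by
  have hdS : S.det = A.det ^ 2 := by rw [← hA, det_mul, sq]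
  have hvol : Measure.map (fun x : EuclideanSpace ℝ (Fin d) => μv + A *ᵥ x.ofLp) volume
      = ENNReal.ofReal (abs (A.det)⁻¹) • (volume : Measure (Fin d → ℝ)) := by
    have h1 : (fun x : EuclideanSpace ℝ (Fin d) => μv + A *ᵥ x.ofLp) =
        (fun x => μv + x) ∘ (toLin' A) ∘ WithLp.ofLp := by
      ext x; simp
    have h0 : Measurable (toLin' A) := (LinearMap.continuous_of_finiteDimensional _).measurable
    rw [h1, ← Measure.map_map (by fun_prop) (by fun_prop), ← Measure.map_map (by fun_prop) (by fun_prop),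
      (PiLp.volume_preserving_ofLp (Fin d)).map_eq, Real.map_matrix_volume_pi_eq_smul_volume_pi hdet,
      Measure.map_smul, map_add_left_eq_self]
  have hT : Measurable (fun x : EuclideanSpace ℝ (Fin d) => μv + A *ᵥ x.ofLp) :=
    measurable_const.add (by
      have : Continuous fun x : EuclideanSpace ℝ (Fin d) => A *ᵥ x.ofLp := by fun_prop
      exact this.measurable)
  rw [stdG_density]
  ext s hs
  rw [Measure.map_apply hT hs, withDensity_apply _ (hT hs), gaussMeasure, withDensity_apply _ hs]
  have hv2 : (volume : Measure (Fin d → ℝ)) = ENNReal.ofReal |A.det| •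
      Measure.map (fun x : EuclideanSpace ℝ (Fin d) => μv + A *ᵥ x.ofLp) volume := by
    rw [hvol, smul_smul, ← ENNReal.ofReal_mul (abs_nonneg _), ← abs_mul, mul_inv_cancel₀ hdet]
    simp
  have hm : Measurable fun x : Fin d → ℝ => ENNReal.ofReal ((Real.sqrt ((2 * π) ^ d * S.det))⁻¹ *
      Real.exp (-((x - μv) ⬝ᵥ (S⁻¹ *ᵥ (x - μv))) / 2)) := by
    apply Measurable.ennreal_ofReal
    apply Continuous.measurable
    fun_prop
  conv_lhs => rw [hv2]
  rw [Measure.restrict_smul, lintegral_smul_measure, setLIntegral_map hs hm hT, smul_eq_mul,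
    ← lintegral_const_mul' _ _ (by simp)]
  apply lintegral_congr
  intro x
  rw [← ENNReal.ofReal_mul (abs_nonneg _)]
  congr 1
  have hu : IsUnit A.det := hdet.isUnit
  have e1 : (μv + A *ᵥ x.ofLp - μv) ⬝ᵥ (S⁻¹ *ᵥ (μv + A *ᵥ x.ofLp - μv)) = ‖x‖ ^ 2 := by
    rw [add_sub_cancel_left, ← hA, Matrix.mul_inv_rev, mulVec_mulVec, Matrix.mul_assoc,
      nonsing_inv_mul _ hu, Matrix.mul_one, EuclideanSpace.norm_sq_eq]
    conv_lhs => rw [← hAt]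
    rw [mulVec_transpose, ← dotProduct_mulVec, mulVec_mulVec, hAt, mul_nonsing_inv _ hu, one_mulVec]
    simp [dotProduct, sq]
  rw [e1, hdS, Real.sqrt_mul (by positivity), Real.sqrt_sq_eq_abs, mul_inv]
  have : |A.det| ≠ 0 := by simpa using hdet
  field_simp
lemma ms_and {α : Type*} [MeasurableSpace α] {f g f' g' : α → ℝ} (hf : Measurable f)
    (hg : Measurable g) (hf' : Measurable f') (hg' : Measurable g') :
    MeasurableSet {a | f a < g a ∧ f' a ≤ g' a} :=
  (measurableSet_lt hf hg).inter (measurableSet_le hf' hg')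

open ProbabilityTheory in
lemma polar_aux (d : ℕ) : ∃ K : ENNReal,
    ∀ (h : Metric.sphere (0 : EuclideanSpace ℝ (Fin d)) 1 → ENNReal) (H : EuclideanSpace ℝ (Fin d) → ENNReal),
    Measurable h → 2 ≤ d →
    (∀ x : ({0}ᶜ : Set (EuclideanSpace ℝ (Fin d))), H x = h (homeomorphUnitSphereProd _ x).1) →
    ∫⁻ x, H x ∂(stdGaussian (EuclideanSpace ℝ (Fin d))) =
      (∫⁻ U, h U ∂((volume : Measure (EuclideanSpace ℝ (Fin d))).toSphere)) * K := by
  let g : ℝ → ENNReal := fun r => ENNReal.ofReal ((Real.sqrt ((2 * π) ^ d))⁻¹ * Real.exp (-r ^ 2 / 2))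
  refine ⟨∫⁻ r : Set.Ioi (0:ℝ), g r ∂(Measure.volumeIoiPow (Module.finrank ℝ (EuclideanSpace ℝ (Fin d)) - 1)), ?_⟩
  intro h H hh hd hH
  have : Nontrivial (EuclideanSpace ℝ (Fin d)) := by
    have : Nonempty (Fin d) := ⟨⟨0, by omega⟩⟩
    infer_instance
  have hg : Measurable g := by fun_prop
  rw [stdG_density, lintegral_withDensity_eq_lintegral_mul_non_measurable _ (by fun_prop)
    (Filter.Eventually.of_forall fun _ => ENNReal.ofReal_lt_top)]
  rw [← lintegral_prod_mul (g := fun r : Set.Ioi (0:ℝ) => g r) hh.aemeasurable (hg.comp measurable_subtype_coe).aemeasurable]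
  rw [← (Measure.measurePreserving_homeomorphUnitSphereProd volume).lintegral_comp
    (f := fun z : _ × Set.Ioi (0:ℝ) => h z.1 * g z.2) ((hh.comp measurable_fst).mul ((hg.comp measurable_subtype_coe).comp measurable_snd))]
  trans ∫⁻ a in ({0}ᶜ : Set (EuclideanSpace ℝ (Fin d))), ((fun x : EuclideanSpace ℝ (Fin d) => ENNReal.ofReal ((√((2 * π) ^ d))⁻¹ * rexp (-‖x‖ ^ 2 / 2))) * H) a
  · rw [restrict_compl_singleton]
  rw [← lintegral_subtype_comap (measurableSet_singleton _).compl]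
  apply lintegral_congr
  intro x
  simp only [Pi.mul_apply, hH, Function.comp, homeomorphUnitSphereProd_apply_snd_coe]
  exact mul_comm _ _

open ProbabilityTheory in
lemma polar (d : ℕ) (hd : 2 ≤ d) (h : Metric.sphere (0 : EuclideanSpace ℝ (Fin d)) 1 → ENNReal)
    (H : EuclideanSpace ℝ (Fin d) → ENNReal) (hh : Measurable h)
    (hH : ∀ x : ({0}ᶜ : Set (EuclideanSpace ℝ (Fin d))), H x = h (homeomorphUnitSphereProd _ x).1) :
    ∫⁻ x, H x ∂(stdGaussian (EuclideanSpace ℝ (Fin d))) = ∫⁻ U, h U ∂(uniformSphere d) := by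
  obtain ⟨K, hK⟩ := polar_aux d
  have h1 := hK (fun _ => 1) (fun _ => 1) measurable_const hd (fun _ => rfl)
  simp only [lintegral_const, one_mul, measure_univ] at h1
  rw [hK h H hh hd hH, uniformSphere, lintegral_smul_measure, smul_eq_mul, mul_comm,
    ENNReal.eq_inv_of_mul_eq_one_left (a := K) (by rw [mul_comm]; exact h1.symm)]

lemma erf_cont : Continuous erf := by
  unfold erf
  apply continuous_const.mul
  exact intervalIntegral.continuous_primitive (fun a b => Continuous.intervalIntegrable (by fun_prop) _ _) 0

lemma erf_nonneg {t : ℝ} (ht : 0 ≤ t) : 0 ≤ erf t := by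
  unfold erf
  have := intervalIntegral.integral_nonneg (μ := volume) (f := fun s => Real.exp (-s^2)) ht (fun _ _ => (Real.exp_pos _).le)
  positivity

open ProbabilityTheory in
lemma gr_Ioc {t : ℝ} (ht : 0 ≤ t) :
    gaussianReal 0 1 (Set.Ioc 0 (Real.sqrt 2 * t)) = ENNReal.ofReal (1 / 2 * erf t) := by
  rw [gaussianReal_apply_eq_integral _ one_ne_zero, ← intervalIntegral.integral_of_le (by positivity)]
  congr 1
  have h := intervalIntegral.integral_comp_mul_left (a := 0) (b := t) (fun x => gaussianPDFReal 0 1 x) (c := Real.sqrt 2) (by positivity)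
  rw [mul_zero, smul_eq_mul, eq_inv_mul_iff_mul_eq₀ (by positivity)] at h
  rw [← h, erf, ← mul_assoc, ← intervalIntegral.integral_const_mul, ← intervalIntegral.integral_const_mul]
  apply intervalIntegral.integral_congr
  intro s _
  simp only [gaussianPDFReal]
  have h2 : Real.sqrt 2 ≠ 0 := by positivity
  have h3 : Real.sqrt π ≠ 0 := by positivity
  have : -(√2 * s - 0)^2 / (2 * ((1:NNReal):ℝ)) = -s^2 := by
    rw [sub_zero, mul_pow, Real.sq_sqrt (by norm_num)]; simp; ring
  rw [this, NNReal.coe_one, mul_one, Real.sqrt_mul (by norm_num)]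
  field_simp

open ProbabilityTheory in
lemma gr_event (c ε : ℝ) (hε : 0 ≤ ε) :
    gaussianReal 0 1 {t : ℝ | 0 < t * c ∧ t / (Real.sqrt 2 * c) ≤ ε} =
      ENNReal.ofReal (1 / 2 * erf (ε * |c|)) := by
  have h2 : 0 < Real.sqrt 2 := by positivity
  have pos : ∀ c : ℝ, 0 < c → {t : ℝ | 0 < t * c ∧ t / (Real.sqrt 2 * c) ≤ ε} = Set.Ioc 0 (Real.sqrt 2 * (ε * c)) := by
    intro c hc
    ext t
    simp only [Set.mem_ofPred_eq, Set.mem_Ioc, mul_pos_iff_of_pos_right hc, div_le_iff₀ (mul_pos h2 hc)]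
    rw [show ε * (√2 * c) = √2 * (ε * c) by ring]
  rcases lt_trichotomy c 0 with hc | hc | hc
  · rw [← gr_Ioc (by positivity), abs_of_neg hc, ← pos (-c) (by linarith)]
    have hg : (gaussianReal 0 1).map (fun x => -x) = gaussianReal 0 1 := by simpa using gaussianReal_map_neg (μ := 0) (v := 1)
    conv_rhs => rw [← hg]
    rw [Measure.map_apply measurable_neg]
    · congr 1
      ext t
      simp
    · rw [pos _ (by linarith)]; exact measurableSet_Ioc
  · subst hc; simp [erf]
  · rw [pos c hc, gr_Ioc (by positivity), abs_of_pos hc]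
open ProbabilityTheory in
lemma inner_law (d : ℕ) (U : EuclideanSpace ℝ (Fin d)) (hU : ‖U‖ = 1) :
    (stdGaussian (EuclideanSpace ℝ (Fin d))).map (fun x => inner ℝ U x) = gaussianReal 0 1 := by
  have := IsGaussian.map_eq_gaussianReal (μ := stdGaussian (EuclideanSpace ℝ (Fin d))) (innerSL ℝ U)
  rw [integral_strongDual_stdGaussian, variance_dual_stdGaussian, innerSL_apply_norm, hU] at this
  simpa using this

open ProbabilityTheory in
lemma core (d : ℕ) (hd : 2 ≤ d) (v : EuclideanSpace ℝ (Fin d)) (ε : ℝ) (hε : 0 ≤ ε) :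
    ((stdGaussian (EuclideanSpace ℝ (Fin d))).prod (stdGaussian (EuclideanSpace ℝ (Fin d))))
      {w | 0 < inner ℝ w.1 w.2 * inner ℝ v w.1 ∧
        inner ℝ w.1 w.2 / (Real.sqrt 2 * inner ℝ v w.1) ≤ ε} =
    ENNReal.ofReal ((1 / 2) *
          ∫ U : Metric.sphere (0 : EuclideanSpace ℝ (Fin d)) 1,
            erf (ε * |(inner ℝ v (U : EuclideanSpace ℝ (Fin d)) : ℝ)|) ∂(uniformSphere d)) := by
  have hcont : Continuous fun U : Metric.sphere (0 : EuclideanSpace ℝ (Fin d)) 1 =>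
      erf (ε * |(inner ℝ v (U : EuclideanSpace ℝ (Fin d)) : ℝ)|) := by
    apply erf_cont.comp
    fun_prop
  have hfin : IsFiniteMeasure (uniformSphere d) := by
    have : Nontrivial (EuclideanSpace ℝ (Fin d)) := by
      have : Nonempty (Fin d) := ⟨⟨0, by omega⟩⟩
      infer_instance
    constructor
    rw [uniformSphere, Measure.smul_apply, smul_eq_mul]
    apply ENNReal.mul_lt_top _ (measure_lt_top _ _)
    rw [ENNReal.inv_lt_top, pos_iff_ne_zero, Ne, Measure.measure_univ_eq_zero]
    exact Measure.toSphere_ne_zero _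
  have hms : MeasurableSet {w : EuclideanSpace ℝ (Fin d) × EuclideanSpace ℝ (Fin d) |
      0 < inner ℝ w.1 w.2 * inner ℝ v w.1 ∧
        inner ℝ w.1 w.2 / (Real.sqrt 2 * inner ℝ v w.1) ≤ ε} := by
    apply ms_and <;> fun_prop
  rw [Measure.prod_apply hms]
  rw [polar d hd (fun U => ENNReal.ofReal (1 / 2 * erf (ε * |(inner ℝ v (U : EuclideanSpace ℝ (Fin d)) : ℝ)|)))]
  · rw [← integral_const_mul, ofReal_integral_eq_lintegral_ofReal]
    · apply Integrable.const_mul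
      exact hcont.integrable_of_hasCompactSupport (HasCompactSupport.of_compactSpace _)
    · refine Filter.Eventually.of_forall fun U => ?_
      have := erf_nonneg (t := ε * |(inner ℝ v (U : EuclideanSpace ℝ (Fin d)) : ℝ)|) (by positivity)
      simp only [Pi.zero_apply]
      positivity
  · exact (continuous_const.mul hcont).measurable.ennreal_ofReal
  · intro x
    set U := (homeomorphUnitSphereProd (EuclideanSpace ℝ (Fin d)) x).1 with hU
    have hx : (x : EuclideanSpace ℝ (Fin d)) ≠ 0 := x.2
    have hr : 0 < ‖(x : EuclideanSpace ℝ (Fin d))‖ := norm_pos_iff.2 hx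
    have hxU : (x : EuclideanSpace ℝ (Fin d)) = ‖(x : EuclideanSpace ℝ (Fin d))‖ • (U : EuclideanSpace ℝ (Fin d)) := by
      rw [hU, homeomorphUnitSphereProd_apply_fst_coe, smul_smul, mul_inv_cancel₀ hr.ne', one_smul]
    generalize ‖(x : EuclideanSpace ℝ (Fin d))‖ = r at hr hxU
    have hU1 : ‖(U : EuclideanSpace ℝ (Fin d))‖ = 1 := by simp
    rw [← gr_event _ _ hε, ← inner_law d U hU1, Measure.map_apply (by fun_prop)]
    · congr 1
      ext m
      simp only [Set.mem_preimage, Set.mem_ofPred_eq]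
      rw [hxU, real_inner_smul_left, real_inner_smul_right]
      generalize inner ℝ (U : EuclideanSpace ℝ (Fin d)) m = a
      generalize inner ℝ v (U : EuclideanSpace ℝ (Fin d)) = c
      rw [show r * a * (r * c) = r ^ 2 * (a * c) by ring, mul_pos_iff_of_pos_left (by positivity),
        show √2 * (r * c) = r * (√2 * c) by ring, mul_div_mul_left _ _ hr.ne']
    · apply ms_and <;> fun_prop

/-- **CDF of the deviation functional for multivariate Gaussians.**
For `X, Y` i.i.d. `N(μ, Σ)`, `θ* = Σ⁻¹μ`, and `u` with `uᵀΣu = 1`, for every `ε ≥ 0` the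
probability that the pair is informative in direction `u` with deviation
`V_{θ*,u}(X,Y) ≤ ε` equals `(1/2) E_U[erf(ε |⟨Σ^{1/2}u, U⟩|)]`, `U` uniform on `S^{d−1}`. -/
theorem stmt18 (d : ℕ) (hd : 2 ≤ d) (S : Matrix (Fin d) (Fin d) ℝ) (hS : S.PosDef)
    (μv : Fin d → ℝ) (u : Fin d → ℝ) (hu : u ⬝ᵥ (S *ᵥ u) = 1) (ε : ℝ) (hε : 0 ≤ ε) :
    ((gaussMeasure d S μv).prod (gaussMeasure d S μv))
        {w : (Fin d → ℝ) × (Fin d → ℝ) |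
          ((w.1 - w.2) ⬝ᵥ (S⁻¹ *ᵥ μv - S⁻¹ *ᵥ ((2 : ℝ)⁻¹ • (w.1 + w.2)))) *
              (u ⬝ᵥ (w.1 - w.2)) < 0 ∧
            ((w.1 - w.2) ⬝ᵥ (S⁻¹ *ᵥ ((2 : ℝ)⁻¹ • (w.1 + w.2)) - S⁻¹ *ᵥ μv)) /
                (u ⬝ᵥ (w.1 - w.2)) ≤ ε}
      = ENNReal.ofReal ((1 / 2) *
          ∫ U : Metric.sphere (0 : EuclideanSpace ℝ (Fin d)) 1,
            erf (ε * |(inner ℝ ((EuclideanSpace.equiv (Fin d) ℝ).symm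
                (CFC.sqrt S *ᵥ u)) (U : EuclideanSpace ℝ (Fin d)) : ℝ)|)
            ∂(uniformSphere d)) := by
  have hAA : CFC.sqrt S * CFC.sqrt S = S := CFC.sqrt_mul_sqrt_self S hS.posSemidef.nonneg
  have hAt : (CFC.sqrt S)ᵀ = CFC.sqrt S := by
    have : (CFC.sqrt S).IsHermitian := (Matrix.nonneg_iff_posSemidef.1 (CFC.sqrt_nonneg S)).isHermitian
    rw [← conjTranspose_eq_transpose_of_trivial]
    exact this
  have hdet : (CFC.sqrt S).det ≠ 0 := by
    intro h
    have h1 := hS.det_pos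
    rw [← hAA, det_mul, h] at h1
    simp at h1
  generalize CFC.sqrt S = A at hAA hAt hdet ⊢
  have hu : IsUnit A.det := hdet.isUnit
  set v := (EuclideanSpace.equiv (Fin d) ℝ).symm (A *ᵥ u) with hv
  rw [← core d hd v ε hε, gauss_map d S A hAt hAA hdet μv]
  have hT : Measurable (fun x : EuclideanSpace ℝ (Fin d) => μv + A *ᵥ x.ofLp) := by
    apply Continuous.measurable
    fun_prop
  rw [Measure.map_prod_map _ _ hT hT, Measure.map_apply (hT.prodMap hT)]
  · conv_rhs => rw [← ProbabilityTheory.IsGaussian.map_rotation_eq_self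
      (μ := ProbabilityTheory.stdGaussian (EuclideanSpace ℝ (Fin d))) (by simp) (-(π / 4))]
    rw [Measure.map_apply (by fun_prop)]
    · congr 1
      ext ⟨x, y⟩
      simp only [Set.mem_preimage, Set.mem_ofPred_eq, Prod.map_apply,
        ContinuousLinearMap.rotation_apply, Real.cos_neg, Real.sin_neg, Real.cos_pi_div_four,
        Real.sin_pi_div_four, neg_neg, neg_smul]
      have e0 : (μv + A *ᵥ x.ofLp) - (μv + A *ᵥ y.ofLp) = A *ᵥ (x.ofLp - y.ofLp) := by
        rw [add_sub_add_left_eq_sub, mulVec_sub]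
      have e1 : S⁻¹ *ᵥ ((2 : ℝ)⁻¹ • ((μv + A *ᵥ x.ofLp) + (μv + A *ᵥ y.ofLp))) - S⁻¹ *ᵥ μv
          = (2 : ℝ)⁻¹ • (A⁻¹ *ᵥ (x.ofLp + y.ofLp)) := by
        rw [← mulVec_sub, show (2 : ℝ)⁻¹ • ((μv + A *ᵥ x.ofLp) + (μv + A *ᵥ y.ofLp)) - μv
          = (2 : ℝ)⁻¹ • (A *ᵥ (x.ofLp + y.ofLp)) by
            rw [mulVec_add]; ext i; simp; ring, mulVec_smul, ← hAA, Matrix.mul_inv_rev,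
            mulVec_mulVec, Matrix.mul_assoc, nonsing_inv_mul _ hu, Matrix.mul_one]
      have e2 : S⁻¹ *ᵥ μv - S⁻¹ *ᵥ ((2 : ℝ)⁻¹ • ((μv + A *ᵥ x.ofLp) + (μv + A *ᵥ y.ofLp)))
          = - ((2 : ℝ)⁻¹ • (A⁻¹ *ᵥ (x.ofLp + y.ofLp))) := by
        rw [← e1, neg_sub]
      have e3 : (A *ᵥ (x.ofLp - y.ofLp)) ⬝ᵥ ((2 : ℝ)⁻¹ • (A⁻¹ *ᵥ (x.ofLp + y.ofLp)))
          = inner ℝ ((√2 / 2) • x + -((√2 / 2) • y)) ((√2 / 2) • x + (√2 / 2) • y) := by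
        rw [← smul_neg, ← smul_add, ← smul_add, real_inner_smul_left, real_inner_smul_right,
          ← mul_assoc, show √2 / 2 * (√2 / 2) = (2 : ℝ)⁻¹ by
            have := Real.mul_self_sqrt (show (0:ℝ) ≤ 2 by norm_num)
            linarith,
          dotProduct_smul, smul_eq_mul]
        congr 1
        conv_lhs => rw [← hAt, mulVec_transpose, ← dotProduct_mulVec, mulVec_mulVec, hAt,
          mul_nonsing_inv _ hu, one_mulVec]
        simp [PiLp.inner_apply, dotProduct, sub_eq_add_neg, mul_comm]
      have e4 : u ⬝ᵥ (A *ᵥ (x.ofLp - y.ofLp)) =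
          √2 * inner ℝ v ((√2 / 2) • x + -((√2 / 2) • y)) := by
        rw [← smul_neg, ← smul_add, real_inner_smul_right, ← mul_assoc,
          show √2 * (√2 / 2) = 1 by
            have := Real.mul_self_sqrt (show (0:ℝ) ≤ 2 by norm_num)
            linarith, one_mul, dotProduct_mulVec, ← mulVec_transpose, hAt]
        simp [hv, PiLp.inner_apply, dotProduct, sub_eq_add_neg, mul_comm]
      rw [e0, e1, e2, dotProduct_neg, e3, e4]
      refine and_congr_left fun _ => ?_
      generalize inner ℝ ((√2 / 2) • x + -((√2 / 2) • y)) ((√2 / 2) • x + (√2 / 2) • y) = a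
      generalize inner ℝ v ((√2 / 2) • x + -((√2 / 2) • y)) = c
      rw [show -a * (√2 * c) = -(√2 * (a * c)) by ring, neg_lt_zero, mul_pos_iff_of_pos_left (by positivity)]
    · apply ms_and <;> fun_prop
  · have h1 : Measurable fun w : (Fin d → ℝ) × (Fin d → ℝ) => u ⬝ᵥ (w.1 - w.2) :=
      Continuous.measurable (by fun_prop)
    refine ms_and (Measurable.mul (Continuous.measurable (by fun_prop)) h1) (by fun_prop)
      (Measurable.div (Continuous.measurable (by fun_prop)) h1) (by fun_prop)
end
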